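/- arXiv:1006.1261 — 2 statements merged into one kernel-verified Lean document; each statement's English description precedes it below -/
import Mathlib

section
/- Let Σ be a totally geodesic hypersurface in a Riemannian manifold M admitting a unit Killing field ξ, and suppose ξ is not tangent to Σ at some point. Writing ξ = T + νN along Σ with N a unit normal, the vector field T extended to a neighborhood of this point in M by means of the local flow of ξ is a local Killing field on M. -/
noncomputable section
open Real Set

/-- Points of the coordinate chart `ℝⁿ`. -/
abbrev Pt (n : ℕ) := Fin n → ℝ

/-- The `i`-th standard coordinate vector. -/
def stdb (n : ℕ) (i : Fin n) : Pt n := Pi.single i 1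

/-- Riemannian metric data in coordinates: a field of symmetric bilinear forms. -/
abbrev Met (n : ℕ) := Pt n → Fin n → Fin n → ℝ

/-- The inner product of the vectors `v`, `w` at the point `x`, with respect to `g`. -/
def minner {n : ℕ} (g : Met n) (x v w : Pt n) : ℝ := ∑ i, ∑ j, g x i j * v i * w j

/-- `g` is a smooth Riemannian metric on `U`. -/
def IsMetricOn {n : ℕ} (U : Set (Pt n)) (g : Met n) : Prop :=
  (∀ i j, ContDiffOn ℝ (⊤ : ℕ∞) (fun x => g x i j) U) ∧
  (∀ x i j, g x i j = g x j i) ∧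
  (∀ x ∈ U, ∀ v : Pt n, v ≠ 0 → 0 < minner g x v v)

/-- The inverse metric `g^{kl}`. -/
def ginv {n : ℕ} (g : Met n) (x : Pt n) : Fin n → Fin n → ℝ :=
  fun k l => (Matrix.of (g x))⁻¹ k l

/-- The Christoffel symbols `Γᵏᵢⱼ` of the Levi-Civita connection of `g`. -/
def christoffel {n : ℕ} (g : Met n) (x : Pt n) (k i j : Fin n) : ℝ :=
  (1/2) * ∑ l, ginv g x k l *
    (fderiv ℝ (fun y => g y j l) x (stdb n i) + fderiv ℝ (fun y => g y i l) x (stdb n j)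
      - fderiv ℝ (fun y => g y i j) x (stdb n l))

/-- The covariant derivative (Levi-Civita connection of `g`) of the vector field `Y`
at the point `x` in the direction `v`. -/
def covD {n : ℕ} (g : Met n) (Y : Pt n → Pt n) (x v : Pt n) : Pt n :=
  fun k => fderiv ℝ (fun y => Y y k) x v + ∑ i, ∑ j, christoffel g x k i j * v i * Y x j

/-- `X` is a Killing field of `g` on `U`. -/
def IsKillingOn {n : ℕ} (U : Set (Pt n)) (g : Met n) (X : Pt n → Pt n) : Prop :=
  ∀ x ∈ U, ∀ v w : Pt n,
    minner g x (covD g X x v) w + minner g x (covD g X x w) v = 0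

/-- `X` has unit length on `U`. -/
def IsUnitOn {n : ℕ} (U : Set (Pt n)) (g : Met n) (X : Pt n → Pt n) : Prop :=
  ∀ x ∈ U, minner g x (X x) (X x) = 1

/-- The Lie bracket `[X,Y]` of two vector fields, in coordinates. -/
def lieB {n : ℕ} (X Y : Pt n → Pt n) (x : Pt n) : Pt n :=
  fun k => fderiv ℝ (fun y => Y y k) x (X x) - fderiv ℝ (fun y => X y k) x (Y x)

/-- A parametrized hypersurface `F : V → ℝ^{n+1}` with a chosen unit normal field `N`. -/
structure Hyp (n : ℕ) where
  V : Set (Pt n)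
  F : Pt n → Pt (n+1)
  N : Pt n → Pt (n+1)

/-- The ambient covariant derivative, along the map `F`, of the ambient-vector-valued
field `W` defined on the parameter domain, in the coordinate direction `v`. -/
def covAlong {n : ℕ} (g : Met (n+1)) (F W : Pt n → Pt (n+1)) (u v : Pt n) : Pt (n+1) :=
  fun k => fderiv ℝ (fun y => W y k) u v +
    ∑ i, ∑ j, christoffel g (F u) k i j * fderiv ℝ F u v i * W u j

/-- `S` is a smooth immersed hypersurface inside the chart `U`, with unit normal `N`. -/
def Hyp.IsRegular {n : ℕ} (S : Hyp n) (U : Set (Pt (n+1))) (g : Met (n+1)) : Prop :=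
  IsOpen S.V ∧ ContDiffOn ℝ (⊤ : ℕ∞) S.F S.V ∧ (∀ u ∈ S.V, S.F u ∈ U) ∧
  (∀ u ∈ S.V, LinearIndependent ℝ (fun a : Fin n => fderiv ℝ S.F u (stdb n a))) ∧
  ContDiffOn ℝ (⊤ : ℕ∞) S.N S.V ∧
  (∀ u ∈ S.V, minner g (S.F u) (S.N u) (S.N u) = 1) ∧
  (∀ u ∈ S.V, ∀ a : Fin n, minner g (S.F u) (S.N u) (fderiv ℝ S.F u (stdb n a)) = 0)

/-- `S` is totally geodesic: the shape operator `X ↦ -∇̃_X N` vanishes. -/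
def Hyp.TotallyGeodesic {n : ℕ} (S : Hyp n) (g : Met (n+1)) : Prop :=
  ∀ u ∈ S.V, ∀ a : Fin n, covAlong g S.F S.N u (stdb n a) = 0

/-- `S` is totally umbilical: the shape operator `X ↦ -∇̃_X N` is pointwise a
multiple of the identity. -/
def Hyp.TotallyUmbilical {n : ℕ} (S : Hyp n) (g : Met (n+1)) : Prop :=
  ∃ lam : Pt n → ℝ, ∀ u ∈ S.V, ∀ a : Fin n,
    covAlong g S.F S.N u (stdb n a) = lam u • fderiv ℝ S.F u (stdb n a)

/-- Projection onto the first `n` coordinates. -/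
def projBase {n : ℕ} (x : Pt (n+1)) : Pt n := fun i => x i.castSucc

/-- The product metric of `g₀` with the Euclidean line (last coordinate). -/
def prodMet {n : ℕ} (g₀ : Met n) : Met (n+1) := fun x i j =>
  Fin.lastCases (Fin.lastCases 1 (fun _ => 0) j)
    (fun i' => Fin.lastCases 0 (fun j' => g₀ (projBase x) i' j') j) i

/-- The coordinate domain of a product `𝕄 × I`. -/
def prodDom {n : ℕ} (U₀ : Set (Pt n)) (I : Set ℝ) : Set (Pt (n+1)) :=
  {x | projBase x ∈ U₀ ∧ x (Fin.last n) ∈ I}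

/-- The unit vertical field `ξ` of a product `𝕄 × I`. -/
def vert (n : ℕ) : Pt (n+1) → Pt (n+1) := fun _ => stdb (n+1) (Fin.last n)

/-- The pullback of the metric `g` under the map `Φ`. -/
def pullMet {n : ℕ} (g : Met n) (Φ : Pt n → Pt n) : Met n :=
  fun x i j => minner g (Φ x) (fderiv ℝ Φ x (stdb n i)) (fderiv ℝ Φ x (stdb n j))

/-- `g` has, on the coordinate domain `W`, the shape `dt² + f(t)² g_M` of a warped
product of an interval (the `0`-th coordinate) with an `n`-dimensional manifold. -/
def IsWarpedForm {n : ℕ} (g : Met (n+1)) (W : Set (Pt (n+1))) : Prop :=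
  ∃ f : ℝ → ℝ, ContDiff ℝ (⊤ : ℕ∞) f ∧ (∀ t, 0 < f t) ∧
    ∀ x ∈ W, g x 0 0 = 1 ∧
      (∀ i : Fin (n+1), i ≠ 0 → g x 0 i = 0 ∧ g x i 0 = 0) ∧
      (∀ i j : Fin (n+1), i ≠ 0 → j ≠ 0 →
        fderiv ℝ (fun y => g y i j / f (y 0) ^ 2) x (stdb (n+1) 0) = 0)

/-- The Riemannian manifold `(U₀, g₀)` has, in a neighborhood of `p`, the structure of a
warped product of an interval of the Euclidean line with an `n`-dimensional manifold:
there is a diffeomorphism `Φ` from a coordinate domain `W` onto a neighborhood of `p`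
pulling `g₀` back to a warped-product metric. -/
def LocallyWarpedAt {n : ℕ} (U₀ : Set (Pt (n+1))) (g₀ : Met (n+1)) (p : Pt (n+1)) : Prop :=
  ∃ (W : Set (Pt (n+1))) (Φ Ψ : Pt (n+1) → Pt (n+1)),
    IsOpen W ∧ ContDiffOn ℝ (⊤ : ℕ∞) Φ W ∧ MapsTo Φ W U₀ ∧
    IsOpen (Φ '' W) ∧ p ∈ Φ '' W ∧
    ContDiffOn ℝ (⊤ : ℕ∞) Ψ (Φ '' W) ∧ (∀ w ∈ W, Ψ (Φ w) = w) ∧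
    IsWarpedForm (pullMet g₀ Φ) W

/-- The Levi-Civita symbol on three indices. -/
def lcSymb (i j k : Fin 3) : ℝ :=
  ((j.val : ℝ) - (i.val : ℝ)) * ((k.val : ℝ) - (i.val : ℝ)) * ((k.val : ℝ) - (j.val : ℝ)) / 2

/-- The cross product of `v` and `w` at `x`, with respect to the metric `g` and the
orientation of the chart. -/
def crossG (g : Met 3) (x v w : Pt 3) : Pt 3 :=
  fun k => Real.sqrt (Matrix.det (Matrix.of (g x))) *
    ∑ l, ginv g x k l * ∑ i, ∑ j, lcSymb l i j * v i * w j

/-- The components `Rˡᵢⱼₖ` of the Riemann curvature tensor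
(`R(∂ᵢ,∂ⱼ)∂ₖ = Rˡᵢⱼₖ ∂ₗ`, with `R(X,Y) = ∇_X∇_Y - ∇_Y∇_X - ∇_{[X,Y]}`). -/
def riem {n : ℕ} (g : Met n) (x : Pt n) (l i j k : Fin n) : ℝ :=
  fderiv ℝ (fun y => christoffel g y l j k) x (stdb n i)
  - fderiv ℝ (fun y => christoffel g y l i k) x (stdb n j)
  + ∑ m, (christoffel g x l i m * christoffel g x m j k
      - christoffel g x l j m * christoffel g x m i k)

/-- The curvature operator `R(v,w)z` at `x`. -/
def riemVec {n : ℕ} (g : Met n) (x v w z : Pt n) : Pt n :=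
  fun l => ∑ i, ∑ j, ∑ k, riem g x l i j k * v i * w j * z k

/-- `g` has constant sectional curvature `c` on `W`. -/
def HasConstCurv {n : ℕ} (W : Set (Pt n)) (g : Met n) (c : ℝ) : Prop :=
  ∀ x ∈ W, ∀ v w : Pt n,
    minner g x (riemVec g x v w w) v
      = c * (minner g x v v * minner g x w w - (minner g x v w) ^ 2)

/-- The Ricci tensor of `g`. -/
def ricci {n : ℕ} (g : Met n) (x : Pt n) (j k : Fin n) : ℝ := ∑ i, riem g x i i j k

/-- The scalar curvature of `g`. -/
def scal {n : ℕ} (g : Met n) (x : Pt n) : ℝ := ∑ j, ∑ k, ginv g x j k * ricci g x j k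

/-- The metric `dx² + sin²θ(x) dy² + cos²θ(x) dz²` on a three-dimensional chart. -/
def tgMet (θ : ℝ → ℝ) : Met 3 := fun x i j =>
  if i = j then
    (if i = 0 then 1 else if i = 1 then (Real.sin (θ (x 0))) ^ 2 else (Real.cos (θ (x 0))) ^ 2)
  else 0

/-- The warped product metric `dt² + f(t)² g₀` (interval coordinate first). -/
def warpMet {n : ℕ} (f : ℝ → ℝ) (g₀ : Met n) : Met (n+1) := fun x i j =>
  Fin.cases (Fin.cases 1 (fun _ => 0) j)
    (fun i' => Fin.cases 0 (fun j' => f (x 0) ^ 2 * g₀ (Fin.tail x) i' j') j) i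

/-- The coordinate domain of a warped product `I ×_f 𝕄` (interval coordinate first). -/
def warpDom {n : ℕ} (I : Set ℝ) (U₀ : Set (Pt n)) : Set (Pt (n+1)) :=
  {x | x 0 ∈ I ∧ Fin.tail x ∈ U₀}

/-- The covariant acceleration of a curve `γ`, whose vanishing defines geodesics. -/
def curveAccel {n : ℕ} (g : Met n) (γ : ℝ → Pt n) (s : ℝ) : Pt n :=
  fun k => deriv (fun t => deriv (fun r => γ r k) t) s +
    ∑ i, ∑ j, christoffel g (γ s) k i j * deriv (fun r => γ r i) s * deriv (fun r => γ r j) s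

/-- The velocity of a curve. -/
def vel {n : ℕ} (γ : ℝ → Pt n) (s : ℝ) : Pt n := fun k => deriv (fun r => γ r k) s

section

open Filter Topology

set_option maxSynthPendingDepth 3

variable {E : Type*} [NormedAddCommGroup E] [NormedSpace ℝ E]

/-- The Lie derivative along `X` of the field of bilinear forms `B`. -/
def lieForm (B : E → E →L[ℝ] E →L[ℝ] ℝ) (X : E → E) (x v w : E) : ℝ :=
  fderiv ℝ B x (X x) v w + B x (fderiv ℝ X x v) w + B x v (fderiv ℝ X x w)

theorem fderiv_lieForm {B : E → E →L[ℝ] E →L[ℝ] ℝ} {X : E → E} {x : E}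
    (hB : ContDiffAt ℝ 2 B x) (hX : ContDiffAt ℝ 2 X x) (v w a : E) :
    fderiv ℝ (fun y => lieForm B X y v w) x a =
      fderiv ℝ (fderiv ℝ B) x a (X x) v w + fderiv ℝ B x (fderiv ℝ X x a) v w
      + (fderiv ℝ B x a (fderiv ℝ X x v) w + B x (fderiv ℝ (fderiv ℝ X) x a v) w)
      + (fderiv ℝ B x a v (fderiv ℝ X x w) + B x v (fderiv ℝ (fderiv ℝ X) x a w)) := by
  have hB0 := (hB.differentiableAt (by norm_num)).hasFDerivAt
  have hX0 := (hX.differentiableAt (by norm_num)).hasFDerivAt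
  have hB1 := ((hB.fderiv_right (m := 1) (by norm_num)).differentiableAt (by norm_num)).hasFDerivAt
  have hX1 := ((hX.fderiv_right (m := 1) (by norm_num)).differentiableAt (by norm_num)).hasFDerivAt
  have c (z : E) := hasFDerivAt_const (𝕜 := ℝ) z x
  have h := ((((hB1.clm_apply hX0).clm_apply (c v)).clm_apply (c w)).add
    ((hB0.clm_apply (hX1.clm_apply (c v))).clm_apply (c w))).add
    ((hB0.clm_apply (c v)).clm_apply (hX1.clm_apply (c w)))
  have h' : HasFDerivAt (fun y => lieForm B X y v w) _ x := h
  rw [h'.fderiv]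
  simp
  ring

theorem lieForm_lieForm_eq_zero {B : E → E →L[ℝ] E →L[ℝ] ℝ} {X Y : E → E} {x : E}
    (hB : ContDiffAt ℝ 2 B x) (hX : ContDiffAt ℝ 2 X x) (hY : ContDiffAt ℝ 2 Y x)
    (hXY : ∀ᶠ y in 𝓝 x, fderiv ℝ Y y (X y) - fderiv ℝ X y (Y y) = 0)
    (hK : ∀ᶠ y in 𝓝 x, ∀ v w, lieForm B X y v w = 0) (v w : E) :
    fderiv ℝ (fun y => lieForm B Y y v w) x (X x) + lieForm B Y x (fderiv ℝ X x v) w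
      + lieForm B Y x v (fderiv ℝ X x w) = 0 := by
  have hX0 := (hX.differentiableAt (by norm_num)).hasFDerivAt
  have hY0 := (hY.differentiableAt (by norm_num)).hasFDerivAt
  have hX1 := ((hX.fderiv_right (m := 1) (by norm_num)).differentiableAt (by norm_num)).hasFDerivAt
  have hY1 := ((hY.fderiv_right (m := 1) (by norm_num)).differentiableAt (by norm_num)).hasFDerivAt
  have hk0 : fderiv ℝ (fun y => lieForm B X y v w) x (Y x) = 0 := by
    have : (fun y => lieForm B X y v w) =ᶠ[𝓝 x] fun _ => (0 : ℝ) := by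
      filter_upwards [hK] with y hy using hy v w
    rw [this.fderiv_eq]; simp
  have hbr (a : E) : fderiv ℝ (fderiv ℝ Y) x a (X x) + fderiv ℝ Y x (fderiv ℝ X x a)
      = fderiv ℝ (fderiv ℝ X) x a (Y x) + fderiv ℝ X x (fderiv ℝ Y x a) := by
    have h1 := (hY1.clm_apply hX0).sub (hX1.clm_apply hY0)
    have h2 : (fun y => fderiv ℝ Y y (X y) - fderiv ℝ X y (Y y)) =ᶠ[𝓝 x] fun _ => (0 : E) := hXY
    have h3 := (h1.congr_of_eventuallyEq h2.symm).unique (hasFDerivAt_const (0 : E) x)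
    have h4 := congrArg (fun L : E →L[ℝ] E => L a) h3
    simp at h4
    rw [← sub_eq_zero, ← h4]; abel
  have hsX := hX.isSymmSndFDerivAt (by simp)
  have hsY := hY.isSymmSndFDerivAt (by simp)
  have hsB := hB.isSymmSndFDerivAt (by simp)
  have hk := hK.self_of_nhds
  have k1 := hk (fderiv ℝ Y x v) w
  have k2 := hk v (fderiv ℝ Y x w)
  have hxy := sub_eq_zero.1 hXY.self_of_nhds
  rw [fderiv_lieForm hB hX] at hk0
  rw [fderiv_lieForm hB hY]
  have b1 := congrArg (fun z => B x z w) (hbr v)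
  have b2 := congrArg (fun z => B x v z) (hbr w)
  simp only [map_add, add_apply] at b1 b2
  unfold lieForm at *
  rw [hsB (X x) (Y x), hsY (X x) v, hsY (X x) w, hxy]
  rw [hsX (Y x) v, hsX (Y x) w] at hk0
  linarith

/-- A nonnegative function on a double cone that vanishes on its base and whose derivative along
a field transverse to the base, and close enough to the axis, is bounded by a multiple of the
function, vanishes identically. -/
theorem eq_zero_of_transport {E₁ : Type*} [NormedAddCommGroup E₁] [NormedSpace ℝ E₁]
    [FiniteDimensional ℝ E₁] {u₀ : E₁} {r : ℝ} {q : E₁ × ℝ → ℝ} {η : E₁ × ℝ → E₁ × ℝ}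
    (hq : ∀ y : E₁ × ℝ, ‖y.1 - u₀‖ + |y.2| < r → DifferentiableAt ℝ q y)
    (hq0 : ∀ y : E₁ × ℝ, ‖y.1 - u₀‖ + |y.2| < r → 0 ≤ q y)
    (hη : ∀ y : E₁ × ℝ, ‖y.1 - u₀‖ + |y.2| < r → ‖(η y).1‖ ≤ 1 / 2 ∧ 1 / 2 ≤ (η y).2)
    (hb : ∀ K : Set (E₁ × ℝ), IsCompact K → (∀ y ∈ K, ‖y.1 - u₀‖ + |y.2| < r) →
      ∃ M, ∀ y ∈ K, |fderiv ℝ q y (η y)| ≤ M * q y)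
    (hinit : ∀ u : E₁, ‖u - u₀‖ < r → q (u, 0) = 0)
    {y : E₁ × ℝ} (hy : ‖y.1 - u₀‖ + |y.2| < r) : q y = 0 := by
  obtain ⟨σ, hσ, hσy⟩ : ∃ σ : ℝ, (σ = 1 ∨ σ = -1) ∧ 0 ≤ σ * y.2 := by
    rcases le_total 0 y.2 with h | h
    · exact ⟨1, Or.inl rfl, by linarith⟩
    · exact ⟨-1, Or.inr rfl, by linarith⟩
  have hσ2 : σ * σ = 1 := by rcases hσ with rfl | rfl <;> norm_num
  have hσa : |σ| = 1 := by rcases hσ with rfl | rfl <;> norm_num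
  set r' := ‖y.1 - u₀‖ + |y.2| with hr'
  set K : Set (E₁ × ℝ) := {z | ‖z.1 - u₀‖ + |z.2| ≤ r' ∧ 0 ≤ σ * z.2} with hKdef
  have hKr : ∀ z ∈ K, ‖z.1 - u₀‖ + |z.2| < r := fun z hz => hz.1.trans_lt hy
  have hKc : IsCompact K := by
    refine Metric.isCompact_of_isClosed_isBounded ?_ ?_
    · have h1 : IsClosed {z : E₁ × ℝ | ‖z.1 - u₀‖ + |z.2| ≤ r'} :=
        isClosed_le (by fun_prop) continuous_const
      have h2 : IsClosed {z : E₁ × ℝ | 0 ≤ σ * z.2} := isClosed_le continuous_const (by fun_prop)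
      exact h1.inter h2
    · refine (Metric.isBounded_closedBall (x := (u₀, (0 : ℝ))) (r := r')).subset fun z hz => ?_
      rw [mem_closedBall_iff_norm, Prod.norm_def]
      have h1 := hz.1
      have := norm_nonneg (z.1 - u₀)
      have := abs_nonneg z.2
      refine max_le ?_ ?_
      · change ‖z.1 - u₀‖ ≤ r'
        linarith
      · change ‖z.2 - 0‖ ≤ r'
        rw [sub_zero, Real.norm_eq_abs]
        linarith
  obtain ⟨M, hM⟩ := hb K hKc hKr
  set C := 2 * |M| + 2 with hC
  set φ : E₁ × ℝ → ℝ := fun z => q z * Real.exp (-(C * σ) * z.2) with hφ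
  have hqd (z) (hz : z ∈ K) := (hq z (hKr z hz)).hasFDerivAt
  have hφc : ContinuousOn φ K := by
    refine ContinuousOn.mul (fun z hz => (hqd z hz).continuousAt.continuousWithinAt) ?_
    fun_prop
  have hyK : y ∈ K := ⟨le_rfl, hσy⟩
  obtain ⟨z, hzK, hzmax⟩ := hKc.exists_isMaxOn ⟨y, hyK⟩ hφc
  suffices hz : q z = 0 by
    have h1 : φ y ≤ φ z := hzmax hyK
    simp only [hφ, hz, zero_mul] at h1
    exact le_antisymm (nonpos_of_mul_nonpos_left h1 (Real.exp_pos _)) (hq0 y hy)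
  rcases hzK.2.eq_or_lt with h0 | hpos
  · have hz2 : z.2 = 0 := by
      have : σ * (σ * z.2) = 0 := by rw [← h0, mul_zero]
      rwa [← mul_assoc, hσ2, one_mul] at this
    have : z = (z.1, 0) := by rw [← hz2]
    rw [this]
    refine hinit _ ?_
    have := hKr z hzK
    rwa [hz2, abs_zero, add_zero] at this
  obtain ⟨hη1, hη2⟩ := hη z (hKr z hzK)
  have hcurve : HasDerivAt (fun t : ℝ => z - (t * σ) • η z) (-(σ • η z)) 0 := by
    have h1 : HasDerivAt (fun t : ℝ => t * σ) σ 0 := by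
      simpa using (hasDerivAt_id (0 : ℝ)).mul_const σ
    exact (h1.smul_const (η z)).const_sub z
  have hcq : HasDerivAt (fun t : ℝ => q (z - (t * σ) • η z)) (fderiv ℝ q z (-(σ • η z))) 0 := by
    have := hqd z hzK
    refine HasFDerivAt.comp_hasDerivAt (f := fun t : ℝ => z - (t * σ) • η z) 0 ?_ hcurve
    simpa using this
  have hce : HasDerivAt (fun t : ℝ => Real.exp (-(C * σ) * (z - (t * σ) • η z).2))
      (Real.exp (-(C * σ) * z.2) * (C * (η z).2)) 0 := by
    have h2 : HasDerivAt (fun t : ℝ => -(C * σ) * (z - (t * σ) • η z).2) (C * (η z).2) 0 := by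
      have := (((hasDerivAt_id (0 : ℝ)).mul_const (σ * (η z).2)).const_sub z.2).const_mul (-(C * σ))
      refine (this.congr_deriv ?_).congr_of_eventuallyEq (Eventually.of_forall fun t => ?_)
      · linear_combination C * (η z).2 * hσ2
      · simp [mul_assoc]
    have := h2.exp
    simpa using this
  have hcφ : HasDerivAt (fun t : ℝ => φ (z - (t * σ) • η z)) _ 0 := hcq.mul hce
  have hmem : ∀ᶠ t in 𝓝[>] (0 : ℝ), z - (t * σ) • η z ∈ K := by
    have : ∀ᶠ t in 𝓝[>] (0 : ℝ), t < σ * z.2 / (η z).2 :=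
      nhdsWithin_le_nhds (eventually_lt_nhds (by positivity))
    filter_upwards [this, self_mem_nhdsWithin] with t ht ht0
    have ht0 : 0 < t := ht0
    rw [lt_div_iff₀ (by linarith)] at ht
    have e1 : σ * (z - (t * σ) • η z).2 = σ * z.2 - t * (η z).2 := by
      simp only [Prod.snd_sub, Prod.smul_snd, smul_eq_mul]
      linear_combination -t * (η z).2 * hσ2
    have habs (s : ℝ) (hs : 0 ≤ σ * s) : |s| = σ * s := by
      rw [← abs_of_nonneg hs, abs_mul, hσa, one_mul]
    have hnn : 0 ≤ σ * (z - (t * σ) • η z).2 := by rw [e1]; linarith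
    refine ⟨?_, hnn⟩
    rw [habs _ hnn, e1]
    have h1 := hzK.1
    rw [habs _ hzK.2] at h1
    have h3 : ‖(z - (t * σ) • η z).1 - u₀‖ ≤ ‖z.1 - u₀‖ + t * ‖(η z).1‖ := by
      have : (z - (t * σ) • η z).1 - u₀ = (z.1 - u₀) - (t * σ) • (η z).1 := by
        simp only [Prod.fst_sub, Prod.smul_fst]; abel
      rw [this]
      refine (norm_sub_le _ _).trans_eq ?_
      rw [norm_smul, Real.norm_eq_abs, abs_mul, hσa, mul_one, abs_of_pos ht0]
    nlinarith
  have hle : fderiv ℝ q z (-(σ • η z)) * Real.exp (-(C * σ) * z.2)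
      + q z * (Real.exp (-(C * σ) * z.2) * (C * (η z).2)) ≤ 0 := by
    have h1 := (hasDerivAt_iff_tendsto_slope.1 hcφ).mono_left
      (nhdsWithin_mono 0 (fun t (ht : t ∈ Ioi (0 : ℝ)) => ne_of_gt ht))
    have h2 := le_of_tendsto h1 (b := 0) (by
      filter_upwards [hmem, self_mem_nhdsWithin] with t ht ht0
      have ht0 : 0 < t := ht0
      have h3 : φ (z - (t * σ) • η z) ≤ φ z := hzmax ht
      rw [slope_def_field]
      simp only [zero_mul, zero_smul, sub_zero]
      exact div_nonpos_of_nonpos_of_nonneg (by linarith) ht0.le)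
    simpa using h2
  have hpos' := Real.exp_pos (-(C * σ) * z.2)
  have hle' : fderiv ℝ q z (-(σ • η z)) + q z * (C * (η z).2) ≤ 0 := by
    refine nonpos_of_mul_nonpos_left (b := Real.exp (-(C * σ) * z.2)) ?_ hpos'
    linarith
  have hM' := hM z hzK
  have hq0' := hq0 z (hKr z hzK)
  have h5 : fderiv ℝ q z (-(σ • η z)) ≥ - (|M| * q z) := by
    rw [map_neg, map_smul, smul_eq_mul]
    have : |σ * fderiv ℝ q z (η z)| ≤ |M| * q z := by
      rw [abs_mul, hσa, one_mul]
      exact hM'.trans (mul_le_mul_of_nonneg_right (le_abs_self M) hq0')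
    linarith [(abs_le.1 this).2]
  have h6 : q z * (C * (1 / 2)) ≤ q z * (C * (η z).2) := by
    have : 0 ≤ C := by positivity
    gcongr
  have : q z ≤ 0 := by nlinarith
  linarith

/-- The metric as a field of continuous bilinear forms. -/
def metricForm {m : ℕ} (g : Met m) (x : Pt m) : Pt m →L[ℝ] Pt m →L[ℝ] ℝ :=
  ∑ i, ∑ j, g x i j • (ContinuousLinearMap.proj (R := ℝ) (φ := fun _ : Fin m => ℝ) i).smulRight
    (ContinuousLinearMap.proj (R := ℝ) (φ := fun _ : Fin m => ℝ) j)

theorem metricForm_apply {m : ℕ} (g : Met m) (x v w : Pt m) :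
    metricForm g x v w = minner g x v w := by
  simp [metricForm, minner, mul_assoc]

theorem metricForm_comm {m : ℕ} {g : Met m} (hsymm : ∀ x i j, g x i j = g x j i) (x v w : Pt m) :
    metricForm g x v w = metricForm g x w v := by
  simp only [metricForm_apply, minner]
  rw [Finset.sum_comm]
  refine Finset.sum_congr rfl fun i _ => Finset.sum_congr rfl fun j _ => ?_
  rw [hsymm x j i]; ring

theorem contDiffOn_metricForm {m : ℕ} {g : Met m} {U : Set (Pt m)} (hg : IsMetricOn U g) :
    ContDiffOn ℝ (⊤ : ℕ∞) (metricForm g) U := by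
  unfold metricForm
  exact ContDiffOn.sum fun i _ => ContDiffOn.sum fun j _ => (hg.1 i j).smul contDiffOn_const

theorem fderiv_metricForm {m : ℕ} {g : Met m} {x : Pt m}
    (hg : ∀ i j, DifferentiableAt ℝ (fun y => g y i j) x) (a v w : Pt m) :
    fderiv ℝ (metricForm g) x a v w
      = ∑ i, ∑ j, fderiv ℝ (fun y => g y i j) x a * v i * w j := by
  have h : HasFDerivAt (metricForm g) _ x :=
    HasFDerivAt.fun_sum fun i _ => HasFDerivAt.fun_sum fun j _ =>
      (hg i j).hasFDerivAt.smul_const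
        ((ContinuousLinearMap.proj (R := ℝ) (φ := fun _ : Fin m => ℝ) i).smulRight
          (ContinuousLinearMap.proj (R := ℝ) (φ := fun _ : Fin m => ℝ) j))
  rw [h.fderiv]
  simp [mul_assoc]

theorem fderiv_metricForm_comm {m : ℕ} {g : Met m} (hsymm : ∀ x i j, g x i j = g x j i)
    {x : Pt m} (hg : ∀ i j, DifferentiableAt ℝ (fun y => g y i j) x) (a v w : Pt m) :
    fderiv ℝ (metricForm g) x a v w = fderiv ℝ (metricForm g) x a w v := by
  rw [fderiv_metricForm hg, fderiv_metricForm hg, Finset.sum_comm]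
  refine Finset.sum_congr rfl fun i _ => Finset.sum_congr rfl fun j _ => ?_
  have : (fun y => g y j i) = fun y => g y i j := funext fun y => hsymm y j i
  rw [this]; ring

/-- The Christoffel symbols as a bilinear map. -/
def christoffelVec {m : ℕ} (g : Met m) (x v w : Pt m) : Pt m :=
  fun k => ∑ i, ∑ j, christoffel g x k i j * v i * w j

theorem sum_mul_ginv {m : ℕ} {g : Met m} {U : Set (Pt m)} (hg : IsMetricOn U g) {x : Pt m}
    (hx : x ∈ U) (p l : Fin m) : ∑ k, g x p k * ginv g x k l = if p = l then 1 else 0 := by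
  have hdet : IsUnit (Matrix.of (g x)).det := by
    rw [isUnit_iff_ne_zero]
    intro h0
    obtain ⟨v, hv0, hv⟩ := Matrix.exists_mulVec_eq_zero_iff.2 h0
    have h1 := hg.2.2 x hx v hv0
    have h2 : minner g x v v = ∑ i, v i * (Matrix.of (g x)).mulVec v i := by
      simp only [minner, Matrix.mulVec, dotProduct, Finset.mul_sum, Matrix.of_apply]
      refine Finset.sum_congr rfl fun i _ => Finset.sum_congr rfl fun j _ => ?_
      ring
    rw [h2, hv] at h1
    simp at h1
  have := congrFun (congrFun (Matrix.mul_nonsing_inv _ hdet) p) l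
  simpa [Matrix.mul_apply, Matrix.one_apply, ginv] using this

/-- The Koszul formula in coordinates. -/
theorem two_mul_metricForm_christoffelVec {m : ℕ} {g : Met m} {U : Set (Pt m)} (hU : IsOpen U)
    (hg : IsMetricOn U g) {x : Pt m} (hx : x ∈ U) (v w z : Pt m) :
    2 * metricForm g x (christoffelVec g x v w) z
      = fderiv ℝ (metricForm g) x v w z + fderiv ℝ (metricForm g) x w v z
        - fderiv ℝ (metricForm g) x z v w := by
  have hd (i j) : DifferentiableAt ℝ (fun y => g y i j) x :=
    ((hg.1 i j).contDiffAt (hU.mem_nhds hx)).differentiableAt (by simp)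
  have key (i j p : Fin m) : 2 * ∑ k, g x k p * christoffel g x k i j
      = fderiv ℝ (fun y => g y j p) x (stdb m i) + fderiv ℝ (fun y => g y i p) x (stdb m j)
        - fderiv ℝ (fun y => g y i j) x (stdb m p) := by
    unfold christoffel
    set A : Fin m → ℝ := fun l => fderiv ℝ (fun y => g y j l) x (stdb m i)
      + fderiv ℝ (fun y => g y i l) x (stdb m j) - fderiv ℝ (fun y => g y i j) x (stdb m l) with hA
    have : ∀ k, g x k p * (1 / 2 * ∑ l, ginv g x k l * A l)
        = 1 / 2 * ∑ l, (g x p k * ginv g x k l) * A l := by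
      intro k
      rw [hg.2.1 x k p, Finset.mul_sum, Finset.mul_sum, Finset.mul_sum]
      refine Finset.sum_congr rfl fun l _ => ?_
      ring
    change 2 * ∑ k, g x k p * (1 / 2 * ∑ l, ginv g x k l * A l) = A p
    rw [Finset.sum_congr rfl fun k _ => this k, ← Finset.mul_sum, Finset.sum_comm]
    simp_rw [← Finset.sum_mul, sum_mul_ginv hg hx]
    simp
  have hlin (f : Pt m → ℝ) (a : Pt m) : fderiv ℝ f x a = ∑ i, fderiv ℝ f x (stdb m i) * a i := by
    conv_lhs => rw [pi_eq_sum_univ' a, map_sum]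
    refine Finset.sum_congr rfl fun i _ => ?_
    rw [map_smul, smul_eq_mul, mul_comm]
    congr 2
  have hlhs : 2 * metricForm g x (christoffelVec g x v w) z
      = ∑ p, ∑ i, ∑ j, (2 * ∑ k, g x k p * christoffel g x k i j) * v i * w j * z p := by
    rw [metricForm_apply, minner, Finset.sum_comm, Finset.mul_sum]
    refine Finset.sum_congr rfl fun p _ => ?_
    simp only [christoffelVec, Finset.mul_sum, Finset.sum_mul]
    rw [Finset.sum_comm]
    refine Finset.sum_congr rfl fun i _ => ?_
    rw [Finset.sum_comm]
    refine Finset.sum_congr rfl fun j _ => Finset.sum_congr rfl fun k _ => ?_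
    ring
  have h1 : fderiv ℝ (metricForm g) x v w z
      = ∑ p, ∑ i, ∑ j, fderiv ℝ (fun y => g y j p) x (stdb m i) * v i * w j * z p := by
    rw [fderiv_metricForm hd, Finset.sum_comm]
    refine Finset.sum_congr rfl fun p _ => ?_
    rw [Finset.sum_comm]
    refine Finset.sum_congr rfl fun j _ => ?_
    rw [hlin _ v, Finset.sum_mul, Finset.sum_mul]
  have h2 : fderiv ℝ (metricForm g) x w v z
      = ∑ p, ∑ i, ∑ j, fderiv ℝ (fun y => g y i p) x (stdb m j) * v i * w j * z p := by
    rw [fderiv_metricForm hd, Finset.sum_comm]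
    refine Finset.sum_congr rfl fun p _ => Finset.sum_congr rfl fun i _ => ?_
    rw [hlin _ w, Finset.sum_mul, Finset.sum_mul]
    refine Finset.sum_congr rfl fun j _ => ?_
    ring
  have h3 : fderiv ℝ (metricForm g) x z v w
      = ∑ p, ∑ i, ∑ j, fderiv ℝ (fun y => g y i j) x (stdb m p) * v i * w j * z p := by
    rw [fderiv_metricForm hd, Finset.sum_comm]
    simp_rw [hlin _ z, Finset.sum_mul]
    rw [Finset.sum_comm_cycle]
    refine Finset.sum_congr rfl fun p _ => ?_
    rw [Finset.sum_comm]
    refine Finset.sum_congr rfl fun i _ => Finset.sum_congr rfl fun j _ => ?_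
    ring
  rw [hlhs, h1, h2, h3]
  simp_rw [key, add_sub_assoc, add_mul, sub_mul, Finset.sum_add_distrib, Finset.sum_sub_distrib]

theorem covD_eq {m : ℕ} {g : Met m} {Y : Pt m → Pt m} {x : Pt m} (hY : DifferentiableAt ℝ Y x)
    (v : Pt m) : covD g Y x v = fderiv ℝ Y x v + christoffelVec g x v (Y x) := by
  funext k
  rw [Pi.add_apply, christoffelVec, covD, fderiv_pi fun i => (differentiableAt_pi.1 hY i)]
  rfl

theorem minner_covD_add {m : ℕ} {g : Met m} {U : Set (Pt m)} (hU : IsOpen U)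
    (hg : IsMetricOn U g) {x : Pt m} (hx : x ∈ U) {Y : Pt m → Pt m}
    (hY : DifferentiableAt ℝ Y x) (v w : Pt m) :
    minner g x (covD g Y x v) w + minner g x (covD g Y x w) v
      = lieForm (metricForm g) Y x v w := by
  have hd (i j) : DifferentiableAt ℝ (fun y => g y i j) x :=
    ((hg.1 i j).contDiffAt (hU.mem_nhds hx)).differentiableAt (by simp)
  have h1 := two_mul_metricForm_christoffelVec hU hg hx v (Y x) w
  have h2 := two_mul_metricForm_christoffelVec hU hg hx w (Y x) v
  have h3 := fderiv_metricForm_comm hg.2.1 hd v (Y x) w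
  have h4 := fderiv_metricForm_comm hg.2.1 hd w (Y x) v
  have h5 := fderiv_metricForm_comm hg.2.1 hd (Y x) w v
  have h6 := metricForm_comm hg.2.1 x v (fderiv ℝ Y x w)
  simp only [← metricForm_apply, covD_eq hY, map_add, add_apply, lieForm]
  linarith

theorem lieB_eq {m : ℕ} {X Y : Pt m → Pt m} {x : Pt m} (hX : DifferentiableAt ℝ X x)
    (hY : DifferentiableAt ℝ Y x) : lieB X Y x = fderiv ℝ Y x (X x) - fderiv ℝ X x (Y x) := by
  funext k
  rw [lieB, fderiv_pi fun i => (differentiableAt_pi.1 hX i),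
    fderiv_pi fun i => (differentiableAt_pi.1 hY i)]
  rfl

theorem covAlong_eq {n : ℕ} {g : Met (n+1)} {F W : Pt n → Pt (n+1)} {u : Pt n}
    (hW : DifferentiableAt ℝ W u) (v : Pt n) :
    covAlong g F W u v = fderiv ℝ W u v + christoffelVec g (F u) (fderiv ℝ F u v) (W u) := by
  funext k
  rw [Pi.add_apply, christoffelVec, covAlong, fderiv_pi fun i => (differentiableAt_pi.1 hW i)]
  rfl

theorem isLinearMap_christoffelVec {m : ℕ} (g : Met m) (x w : Pt m) :
    IsLinearMap ℝ fun v => christoffelVec g x v w where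
  map_add a b := by
    funext k
    simp [christoffelVec, mul_add, add_mul, Finset.sum_add_distrib]
  map_smul c a := by
    funext k
    simp only [christoffelVec, Pi.smul_apply, smul_eq_mul, Finset.mul_sum]
    refine Finset.sum_congr rfl fun i _ => Finset.sum_congr rfl fun j _ => ?_
    ring

theorem lieForm_comm {m : ℕ} {g : Met m} (hsymm : ∀ x i j, g x i j = g x j i) {x : Pt m}
    (hg : ∀ i j, DifferentiableAt ℝ (fun y => g y i j) x) (X : Pt m → Pt m) (v w : Pt m) :
    lieForm (metricForm g) X x v w = lieForm (metricForm g) X x w v := by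
  simp only [lieForm]
  rw [fderiv_metricForm_comm hsymm hg _ v w, metricForm_comm hsymm x v,
    metricForm_comm hsymm x _ w]
  ring

theorem fderiv_unit_normal {n : ℕ} {U : Set (Pt (n+1))} {g : Met (n+1)} {S : Hyp n}
    (hS : S.IsRegular U g) (hgeo : S.TotallyGeodesic g) {u : Pt n} (hu : u ∈ S.V) (v : Pt n) :
    fderiv ℝ S.N u v = -christoffelVec g (S.F u) (fderiv ℝ S.F u v) (S.N u) := by
  have hN : DifferentiableAt ℝ S.N u :=
    (hS.2.2.2.2.1.contDiffAt (hS.1.mem_nhds hu)).differentiableAt (by simp)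
  have h : (fderiv ℝ S.N u : Pt n →ₗ[ℝ] Pt (n+1))
      = -((isLinearMap_christoffelVec g (S.F u) (S.N u)).mk' _ ∘ₗ
          (fderiv ℝ S.F u : Pt n →ₗ[ℝ] Pt (n+1))) := by
    refine (Pi.basisFun ℝ (Fin n)).ext fun a => ?_
    have := hgeo u hu a
    rw [covAlong_eq hN] at this
    simpa [stdb] using eq_neg_of_add_eq_zero_left this
  exact congrArg (fun L : Pt n →ₗ[ℝ] Pt (n+1) => L v) h

/-- The Lie derivative of the metric along the invariant extension of the tangential part vanishes
at the points of the hypersurface. -/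
theorem lieForm_eq_zero_of_totallyGeodesic {n : ℕ} {U : Set (Pt (n+1))} (hU : IsOpen U)
    {g : Met (n+1)} (hg : IsMetricOn U g) {ξ : Pt (n+1) → Pt (n+1)}
    (hξs : ContDiffOn ℝ (⊤ : ℕ∞) ξ U) (hξu : IsUnitOn U g ξ) (hξk : IsKillingOn U g ξ)
    {S : Hyp n} (hS : S.IsRegular U g) (hgeo : S.TotallyGeodesic g) {W : Set (Pt (n+1))}
    (hW : IsOpen W) {Tt : Pt (n+1) → Pt (n+1)}
    (hT : ContDiffOn ℝ (⊤ : ℕ∞) Tt W) (hbr : ∀ x ∈ W, lieB ξ Tt x = 0)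
    (hres : ∀ u ∈ S.V, S.F u ∈ W →
      Tt (S.F u) = ξ (S.F u) - minner g (S.F u) (ξ (S.F u)) (S.N u) • S.N u)
    {u : Pt n} (hu : u ∈ S.V) (huW : S.F u ∈ W) :
    (∀ v w, lieForm (metricForm g) Tt (S.F u) (fderiv ℝ S.F u v) (fderiv ℝ S.F u w) = 0) ∧
    (∀ v, lieForm (metricForm g) Tt (S.F u) (fderiv ℝ S.F u v) (ξ (S.F u)) = 0) ∧
    lieForm (metricForm g) Tt (S.F u) (ξ (S.F u)) (ξ (S.F u)) = 0 := by
  have hxU := hS.2.2.1 u hu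
  have hd (i j) : DifferentiableAt ℝ (fun y => g y i j) (S.F u) :=
    ((hg.1 i j).contDiffAt (hU.mem_nhds hxU)).differentiableAt (by simp)
  have hN : HasFDerivAt S.N (fderiv ℝ S.N u) u :=
    ((hS.2.2.2.2.1.contDiffAt (hS.1.mem_nhds hu)).differentiableAt (by simp)).hasFDerivAt
  have hF : HasFDerivAt S.F (fderiv ℝ S.F u) u :=
    ((hS.2.1.contDiffAt (hS.1.mem_nhds hu)).differentiableAt (by simp)).hasFDerivAt
  have hξd : HasFDerivAt ξ (fderiv ℝ ξ (S.F u)) (S.F u) :=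
    ((hξs.contDiffAt (hU.mem_nhds hxU)).differentiableAt (by simp)).hasFDerivAt
  have hTd : HasFDerivAt Tt (fderiv ℝ Tt (S.F u)) (S.F u) :=
    ((hT.contDiffAt (hW.mem_nhds huW)).differentiableAt (by simp)).hasFDerivAt
  have hGd : HasFDerivAt (metricForm g) (fderiv ℝ (metricForm g) (S.F u)) (S.F u) :=
    (((contDiffOn_metricForm hg).contDiffAt (hU.mem_nhds hxU)).differentiableAt
      (by simp)).hasFDerivAt
  have hbr0 : fderiv ℝ Tt (S.F u) (ξ (S.F u)) = fderiv ℝ ξ (S.F u) (Tt (S.F u)) := by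
    have := hbr _ huW
    rw [lieB_eq hξd.differentiableAt hTd.differentiableAt] at this
    exact sub_eq_zero.1 this
  have hunit (a : Pt (n+1)) : fderiv ℝ (metricForm g) (S.F u) a (ξ (S.F u)) (ξ (S.F u))
      + 2 * metricForm g (S.F u) (fderiv ℝ ξ (S.F u) a) (ξ (S.F u)) = 0 := by
    have h1 := (hGd.clm_apply hξd).clm_apply hξd
    have h2 : (fun y => metricForm g y (ξ y) (ξ y)) =ᶠ[𝓝 (S.F u)] fun _ => (1 : ℝ) := by
      filter_upwards [hU.mem_nhds hxU] with y hy
      rw [metricForm_apply]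
      exact hξu y hy
    have h3 := (h1.congr_of_eventuallyEq h2.symm).unique (hasFDerivAt_const (1 : ℝ) (S.F u))
    have h4 := congrArg (fun L : Pt (n+1) →L[ℝ] ℝ => L a) h3
    simp at h4
    rw [metricForm_comm hg.2.1 _ (ξ (S.F u))] at h4
    linarith
  have hkill (a b : Pt (n+1)) : lieForm (metricForm g) ξ (S.F u) a b = 0 := by
    rw [← minner_covD_add hU hg hxU hξd.differentiableAt]
    exact hξk _ hxU a b
  have hnu := (((hGd.comp u hF).clm_apply (hξd.comp u hF)).clm_apply hN)
  have hres' : (fun y => Tt (S.F y)) =ᶠ[𝓝 u] fun y => ξ (S.F y)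
      - metricForm g (S.F y) (ξ (S.F y)) (S.N y) • S.N y := by
    filter_upwards [hS.1.mem_nhds hu, hF.continuousAt.preimage_mem_nhds (hW.mem_nhds huW)]
      with y hy hyW
    rw [metricForm_apply]
    exact hres y hy hyW
  have hTF (v : Pt n) : fderiv ℝ Tt (S.F u) (fderiv ℝ S.F u v)
      = fderiv ℝ ξ (S.F u) (fderiv ℝ S.F u v)
        - ((fderiv ℝ (metricForm g) (S.F u) (fderiv ℝ S.F u v) (ξ (S.F u)) (S.N u)
            + metricForm g (S.F u) (fderiv ℝ ξ (S.F u) (fderiv ℝ S.F u v)) (S.N u)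
            + metricForm g (S.F u) (ξ (S.F u)) (fderiv ℝ S.N u v)) • S.N u
          + metricForm g (S.F u) (ξ (S.F u)) (S.N u) • fderiv ℝ S.N u v) := by
    have h1 := ((hξd.comp u hF).sub (hnu.smul hN)).congr_of_eventuallyEq hres'
    have h2 := congrArg (fun L : Pt n →L[ℝ] Pt (n+1) => L v) ((hTd.comp u hF).unique h1)
    simp at h2
    rw [h2]
    module
  have hkos (v : Pt n) (z : Pt (n+1)) : 2 * metricForm g (S.F u) (fderiv ℝ S.N u v) z
      = -(fderiv ℝ (metricForm g) (S.F u) (fderiv ℝ S.F u v) (S.N u) z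
        + fderiv ℝ (metricForm g) (S.F u) (S.N u) (fderiv ℝ S.F u v) z
        - fderiv ℝ (metricForm g) (S.F u) z (fderiv ℝ S.F u v) (S.N u)) := by
    rw [fderiv_unit_normal hS hgeo hu, ← two_mul_metricForm_christoffelVec hU hg hxU]
    simp
  have hTx : Tt (S.F u) = ξ (S.F u) - metricForm g (S.F u) (ξ (S.F u)) (S.N u) • S.N u :=
    hres'.self_of_nhds
  have hn (v : Pt n) : metricForm g (S.F u) (S.N u) (fderiv ℝ S.F u v) = 0 := by
    have h : ((metricForm g (S.F u) (S.N u)).comp (fderiv ℝ S.F u) : Pt n →ₗ[ℝ] ℝ) = 0 := by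
      refine (Pi.basisFun ℝ (Fin n)).ext fun a => ?_
      have := hS.2.2.2.2.2.2 u hu a
      rw [← metricForm_apply] at this
      simpa [stdb] using this
    exact congrArg (fun L : Pt n →ₗ[ℝ] ℝ => L v) h
  have hcomm := metricForm_comm hg.2.1 (S.F u)
  have hdcomm := fderiv_metricForm_comm hg.2.1 hd
  unfold lieForm at hkill ⊢
  generalize metricForm g (S.F u) = G at *
  generalize fderiv ℝ (metricForm g) (S.F u) = DG at *
  generalize fderiv ℝ ξ (S.F u) = Dξ at *
  generalize fderiv ℝ Tt (S.F u) = DT at *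
  generalize fderiv ℝ S.N u = DN at *
  generalize fderiv ℝ S.F u = D at *
  generalize ξ (S.F u) = X at *
  generalize S.N u = N at *
  rw [hTx] at hbr0 ⊢
  refine ⟨fun v w => ?_, fun v => ?_, ?_⟩
  · rw [hTF, hTF]
    simp only [map_sub, map_add, map_smul, sub_apply, add_apply, smul_apply, smul_eq_mul]
    have k1 := hkill (D v) (D w)
    have k2 := hkos v (D w)
    have k3 := hkos w (D v)
    rw [hcomm (D v) (DN w), hcomm (D v) N, hn, hn]
    linear_combination k1 - (G X N) / 2 * (k2 + k3) + (G X N) / 2 * (hdcomm (D v) N (D w)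
      + hdcomm (D w) N (D v) - hdcomm N (D v) (D w))
  · rw [hTF, hbr0]
    have k1 := hkill (D v) X
    have k2 := hkill (D v) (X - G X N • N)
    have k3 := hkos v X
    simp only [map_sub, map_add, map_smul, sub_apply, add_apply, smul_apply, smul_eq_mul]
      at k1 k2 ⊢
    rw [hcomm X (DN v), hcomm N X]
    linear_combination k2 - (G X N) * (k3 + hdcomm (D v) X N)
  · rw [hbr0]
    have k := hunit (X - G X N • N)
    rw [hcomm X (Dξ _)]
    linarith


theorem differentiableAt_lieForm {B : E → E →L[ℝ] E →L[ℝ] ℝ} {X : E → E} {x : E}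
    (hB : ContDiffAt ℝ 2 B x) (hX : ContDiffAt ℝ 2 X x) (v w : E) :
    DifferentiableAt ℝ (fun y => lieForm B X y v w) x := by
  have hB0 := hB.differentiableAt (by norm_num)
  have hX0 := hX.differentiableAt (by norm_num)
  have hB1 := (hB.fderiv_right (m := 1) (by norm_num)).differentiableAt (by norm_num)
  have hX1 := (hX.fderiv_right (m := 1) (by norm_num)).differentiableAt (by norm_num)
  have c (z : E) := differentiableAt_const (𝕜 := ℝ) (x := x) z
  exact ((((hB1.clm_apply hX0).clm_apply (c v)).clm_apply (c w)).add
    ((hB0.clm_apply (hX1.clm_apply (c v))).clm_apply (c w))).add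
    ((hB0.clm_apply (c v)).clm_apply (hX1.clm_apply (c w)))

/-- The Lie derivative of a bilinear form, as a continuous bilinear form. -/
def lieFormCLM (B : E → E →L[ℝ] E →L[ℝ] ℝ) (X : E → E) (x : E) : E →L[ℝ] E →L[ℝ] ℝ :=
  fderiv ℝ B x (X x) + (B x).comp (fderiv ℝ X x) + ((B x).flip.comp (fderiv ℝ X x)).flip

theorem lieFormCLM_apply (B : E → E →L[ℝ] E →L[ℝ] ℝ) (X : E → E) (x v w : E) :
    lieFormCLM B X x v w = lieForm B X x v w := by
  simp [lieFormCLM, lieForm]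

theorem eq_sum_stdb {m : ℕ} (v : Pt m) : v = ∑ i, v i • stdb m i := by
  simpa [stdb] using ((Pi.basisFun ℝ (Fin m)).sum_repr v).symm

/-- The infinitesimal action of an endomorphism on bilinear forms is bounded with respect to the
Hilbert-Schmidt norm. -/
theorem abs_sum_mul_le {m : ℕ} (A : Pt m →L[ℝ] Pt m →L[ℝ] ℝ) (L : Pt m →L[ℝ] Pt m) {b : ℝ}
    (hb : ‖L‖ ≤ b) :
    |∑ i, ∑ j, 2 * (A (stdb m i) (stdb m j)) *
        (A (L (stdb m i)) (stdb m j) + A (stdb m i) (L (stdb m j)))|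
      ≤ (m * (m * (m * b * 4))) * ∑ i, ∑ j, A (stdb m i) (stdb m j) ^ 2 := by
  set q := ∑ i, ∑ j, A (stdb m i) (stdb m j) ^ 2 with hq
  have hA (i j) : A (stdb m i) (stdb m j) ^ 2 ≤ q :=
    (Finset.single_le_sum (f := fun j => A (stdb m i) (stdb m j) ^ 2)
      (fun _ _ => sq_nonneg _) (Finset.mem_univ j)).trans
    (Finset.single_le_sum (f := fun i => ∑ j, A (stdb m i) (stdb m j) ^ 2)
      (fun _ _ => Finset.sum_nonneg fun _ _ => sq_nonneg _) (Finset.mem_univ i))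
  have hL (i k : Fin m) : |L (stdb m i) k| ≤ b := by
    have h1 := (norm_le_pi_norm (L (stdb m i)) k).trans (L.le_opNorm (stdb m i))
    have h2 : ‖stdb m i‖ = 1 := by rw [stdb, Pi.norm_single, norm_one]
    rw [h2, mul_one] at h1
    exact h1.trans hb
  have hb0 : 0 ≤ b := (norm_nonneg L).trans hb
  have hprod (i j k l) (c : ℝ) (hc : |c| ≤ b) :
      |2 * (A (stdb m i) (stdb m j)) * (c * A (stdb m k) (stdb m l))| ≤ b * (2 * q) := by
    have h1 : |2 * (A (stdb m i) (stdb m j)) * (c * A (stdb m k) (stdb m l))|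
        = |c| * |2 * (A (stdb m i) (stdb m j)) * (A (stdb m k) (stdb m l))| := by
      rw [← abs_mul]; congr 1; ring
    rw [h1]
    refine mul_le_mul hc ?_ (abs_nonneg _) hb0
    rw [abs_le]
    constructor <;>
      nlinarith [sq_nonneg (A (stdb m i) (stdb m j) + A (stdb m k) (stdb m l)),
        sq_nonneg (A (stdb m i) (stdb m j) - A (stdb m k) (stdb m l)), hA i j, hA k l]
  have hterm (i j) : |2 * (A (stdb m i) (stdb m j)) *
      (A (L (stdb m i)) (stdb m j) + A (stdb m i) (L (stdb m j)))| ≤ m * b * 4 * q := by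
    have e1 : A (L (stdb m i)) (stdb m j)
        = ∑ k, L (stdb m i) k * A (stdb m k) (stdb m j) := by
      conv_lhs => rw [eq_sum_stdb (L (stdb m i))]
      simp [map_sum]
    have e2 : A (stdb m i) (L (stdb m j))
        = ∑ k, L (stdb m j) k * A (stdb m i) (stdb m k) := by
      conv_lhs => rw [eq_sum_stdb (L (stdb m j))]
      simp [map_sum]
    rw [e1, e2, ← Finset.sum_add_distrib, Finset.mul_sum]
    refine (Finset.abs_sum_le_sum_abs _ _).trans ?_
    refine (Finset.sum_le_card_nsmul _ _ (b * (2 * q) + b * (2 * q)) fun k _ => ?_).trans_eq ?_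
    · rw [mul_add]
      exact (abs_add_le _ _).trans (add_le_add (hprod i j k j _ (hL i k)) (hprod i j i k _ (hL j k)))
    · simp; ring
  refine (Finset.abs_sum_le_sum_abs _ _).trans ?_
  refine (Finset.sum_le_card_nsmul _ _ (m * (m * b * 4 * q)) fun i _ => ?_).trans_eq ?_
  · refine (Finset.abs_sum_le_sum_abs _ _).trans ?_
    refine (Finset.sum_le_card_nsmul _ _ (m * b * 4 * q) fun j _ => hterm i j).trans_eq ?_
    simp
  · simp; ring

/-- Adding a transverse direction to the tangent space of a hypersurface spans everything. -/
theorem exists_equiv_of_transverse {n : ℕ} {U : Set (Pt (n+1))} {g : Met (n+1)} {S : Hyp n}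
    (hS : S.IsRegular U g) {u : Pt n} (hu : u ∈ S.V) {a : Pt (n+1)}
    (ha : minner g (S.F u) a (S.N u) ≠ 0) (hsymm : ∀ x i j, g x i j = g x j i) :
    ∃ e : (Pt n × ℝ) ≃L[ℝ] Pt (n+1), (e : (Pt n × ℝ) →L[ℝ] Pt (n+1))
      = (fderiv ℝ S.F u).comp (ContinuousLinearMap.fst ℝ (Pt n) ℝ)
        + (ContinuousLinearMap.snd ℝ (Pt n) ℝ).smulRight a := by
  set L := (fderiv ℝ S.F u).comp (ContinuousLinearMap.fst ℝ (Pt n) ℝ)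
        + (ContinuousLinearMap.snd ℝ (Pt n) ℝ).smulRight a with hL
  have hsum (v : Pt n) : fderiv ℝ S.F u v = ∑ i, v i • fderiv ℝ S.F u (stdb n i) := by
    conv_lhs => rw [eq_sum_stdb v]
    simp [map_sum]
  have hinj : Function.Injective (L : (Pt n × ℝ) →ₗ[ℝ] Pt (n+1)) := by
    rw [← LinearMap.ker_eq_bot, LinearMap.ker_eq_bot']
    rintro ⟨v, s⟩ h
    have h1 : fderiv ℝ S.F u v + s • a = 0 := by simpa [hL] using h
    have h2 : metricForm g (S.F u) (S.N u) (fderiv ℝ S.F u v) = 0 := by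
      rw [hsum, map_sum]
      refine Finset.sum_eq_zero fun i _ => ?_
      rw [map_smul, metricForm_apply, hS.2.2.2.2.2.2 u hu i, smul_zero]
    have hs : s = 0 := by
      have h3 := congrArg (metricForm g (S.F u) (S.N u)) h1
      rw [map_add, h2, map_smul, map_zero, zero_add, metricForm_comm hsymm, metricForm_apply,
        smul_eq_mul] at h3
      exact (mul_eq_zero.1 h3).resolve_right ha
    rw [hs, zero_smul, add_zero, hsum] at h1
    have hv := Fintype.linearIndependent_iff.1 (hS.2.2.2.1 u hu) v h1
    rw [hs]
    exact Prod.ext (funext hv) rfl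
  refine ⟨(LinearEquiv.ofInjectiveOfFinrankEq (L : (Pt n × ℝ) →ₗ[ℝ] Pt (n+1)) hinj
    (by simp)).toContinuousLinearEquiv, ?_⟩
  exact ContinuousLinearMap.ext fun _ => rfl

/-- Near a point where `ξ` is transverse to the hypersurface, the map `(u, s) ↦ F u + s • ξ (F u₀)`
is a local diffeomorphism, and it pulls `ξ` back to a field `η` close to `∂/∂s`. -/
theorem exists_transport_cone {n : ℕ} {U : Set (Pt (n+1))} (hU : IsOpen U)
    {g : Met (n+1)} (hg : IsMetricOn U g)
    {ξ : Pt (n+1) → Pt (n+1)} (hξs : ContDiffOn ℝ (⊤ : ℕ∞) ξ U)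
    {S : Hyp n} (hS : S.IsRegular U g) {u₀ : Pt n} (hu₀ : u₀ ∈ S.V)
    (htrans : minner g (S.F u₀) (ξ (S.F u₀)) (S.N u₀) ≠ 0) :
    ∃ (r : ℝ) (Φ : Pt n × ℝ → Pt (n+1)) (η : Pt n × ℝ → Pt n × ℝ), 0 < r ∧
      (∀ u, Φ (u, 0) = S.F u) ∧
      ∀ y : Pt n × ℝ, ‖y.1 - u₀‖ + |y.2| < r → y.1 ∈ S.V ∧ Φ y ∈ U ∧
        ‖(η y).1‖ ≤ 1 / 2 ∧ 1 / 2 ≤ (η y).2 ∧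
        ∃ e : (Pt n × ℝ) ≃L[ℝ] Pt (n+1), HasStrictFDerivAt Φ (e : (Pt n × ℝ) →L[ℝ] Pt (n+1)) y ∧
          e (η y) = ξ (Φ y) ∧
          ∃ a, ∀ v s, e (v, s) = fderiv ℝ S.F y.1 v + s • a := by
  set a := ξ (S.F u₀) with ha
  set y₀ : Pt n × ℝ := (u₀, 0) with hy₀
  let Φ : Pt n × ℝ → Pt (n+1) := fun y => S.F y.1 + y.2 • a
  let L : Pt n × ℝ → (Pt n × ℝ) →L[ℝ] Pt (n+1) := fun y =>
    (fderiv ℝ S.F y.1).comp (ContinuousLinearMap.fst ℝ (Pt n) ℝ)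
      + (ContinuousLinearMap.snd ℝ (Pt n) ℝ).smulRight a
  let η : Pt n × ℝ → Pt n × ℝ := fun y => (L y).inverse (ξ (Φ y))
  have hΦd (y : Pt n × ℝ) (hy : y.1 ∈ S.V) : HasStrictFDerivAt Φ (L y) y := by
    have hF := (hS.2.1.contDiffAt (hS.1.mem_nhds hy)).hasStrictFDerivAt (by simp)
    exact (hF.comp y hasStrictFDerivAt_fst).add (hasStrictFDerivAt_snd.smul_const a)
  have hΦ0 (u) : Φ (u, 0) = S.F u := by simp [Φ]
  have hLc : ContinuousAt L y₀ := by
    have h1 : ContinuousAt (fderiv ℝ S.F) y₀.1 :=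
      ((hS.2.1.contDiffAt (hS.1.mem_nhds hu₀)).fderiv_right (m := 1)
        (WithTop.coe_le_coe.2 le_top)).continuousAt
    have h2 : ContinuousAt (fun y : Pt n × ℝ => fderiv ℝ S.F y.1) y₀ :=
      ContinuousAt.comp h1 continuousAt_fst
    exact (h2.clm_comp continuousAt_const).add continuousAt_const
  obtain ⟨e₀, he₀⟩ := exists_equiv_of_transverse hS hu₀ htrans hg.2.1
  have he₀' : L y₀ = e₀ := he₀.symm
  have hΦc : ContinuousAt Φ y₀ := (hΦd y₀ hu₀).continuousAt
  have hΦy₀ : Φ y₀ = S.F u₀ := hΦ0 u₀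
  have hξc : ContinuousAt ξ (Φ y₀) := by
    rw [hΦy₀]
    exact (hξs.contDiffAt (hU.mem_nhds (hS.2.2.1 u₀ hu₀))).continuousAt
  have hηc : ContinuousAt η y₀ := by
    have h1 : ContinuousAt ContinuousLinearMap.inverse (L y₀) := by
      rw [he₀']
      exact (contDiffAt_map_inverse (𝕜 := ℝ) (n := 1) e₀).continuousAt
    exact (ContinuousAt.comp h1 hLc).clm_apply (ContinuousAt.comp hξc hΦc)
  have hηy₀ : η y₀ = (0, 1) := by
    have h1 : e₀ (0, 1) = ξ (Φ y₀) := by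
      rw [hΦy₀, ← ContinuousLinearEquiv.coe_coe, he₀]
      simp [ha]
    change (L y₀).inverse (ξ (Φ y₀)) = _
    rw [he₀', ← h1, ContinuousLinearMap.inverse_equiv]
    simp
  have ev1 : ∀ᶠ y in 𝓝 y₀, y.1 ∈ S.V := continuousAt_fst.eventually (hS.1.mem_nhds hu₀)
  have ev2 : ∀ᶠ y in 𝓝 y₀, Φ y ∈ U := by
    refine hΦc.eventually (hU.mem_nhds ?_)
    rw [hΦy₀]
    exact hS.2.2.1 u₀ hu₀
  have ev3 : ∀ᶠ y in 𝓝 y₀, L y ∈ range ((↑) : ((Pt n × ℝ) ≃L[ℝ] Pt (n+1)) → _) := by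
    refine hLc.eventually ?_
    rw [he₀']
    exact ContinuousLinearEquiv.nhds e₀
  have ev4 : ∀ᶠ y in 𝓝 y₀, ‖(η y).1‖ < 1 / 2 := by
    have : ContinuousAt (fun y => ‖(η y).1‖) y₀ := (continuousAt_fst.comp hηc).norm
    refine this.eventually_lt continuousAt_const ?_
    rw [hηy₀]; norm_num
  have ev5 : ∀ᶠ y in 𝓝 y₀, 1 / 2 < (η y).2 := by
    refine continuousAt_const.eventually_lt (continuousAt_snd.comp hηc) ?_
    simp only [hηy₀]; norm_num
  obtain ⟨r, hr, hball⟩ := Metric.eventually_nhds_iff_ball.1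
    (ev1.and (ev2.and (ev3.and (ev4.and ev5))))
  refine ⟨r, Φ, η, hr, hΦ0, fun y hy => ?_⟩
  have hyb : y ∈ Metric.ball y₀ r := by
    rw [mem_ball_iff_norm, Prod.norm_def]
    refine max_lt ?_ ?_
    · change ‖y.1 - u₀‖ < r
      linarith [abs_nonneg y.2]
    · change ‖y.2 - 0‖ < r
      rw [sub_zero, Real.norm_eq_abs]
      linarith [norm_nonneg (y.1 - u₀)]
  obtain ⟨h1, h2, ⟨e, he⟩, h4, h5⟩ := hball y hyb
  refine ⟨h1, h2, h4.le, h5.le, e, ?_, ?_, a, fun v s => ?_⟩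
  · rw [he]; exact hΦd y h1
  · change e ((L y).inverse (ξ (Φ y))) = _
    rw [← he, ContinuousLinearMap.inverse_equiv]
    simp
  · rw [← ContinuousLinearEquiv.coe_coe, he]
    simp [L]

/-- An extension, invariant under the flow of a unit Killing field `ξ`, of the tangential part of `ξ`
along a totally geodesic hypersurface transverse to `ξ` is a local Killing field. -/
theorem isKillingOn_of_invariant_extension {n : ℕ} {U : Set (Pt (n+1))} (hU : IsOpen U)
    {g : Met (n+1)} (hg : IsMetricOn U g)
    {ξ : Pt (n+1) → Pt (n+1)} (hξs : ContDiffOn ℝ (⊤ : ℕ∞) ξ U)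
    (hξu : IsUnitOn U g ξ) (hξk : IsKillingOn U g ξ)
    {S : Hyp n} (hS : S.IsRegular U g) (hgeo : S.TotallyGeodesic g)
    {u₀ : Pt n} (hu₀ : u₀ ∈ S.V)
    (htrans : minner g (S.F u₀) (ξ (S.F u₀)) (S.N u₀) ≠ 0) :
    ∃ W : Set (Pt (n+1)), IsOpen W ∧ S.F u₀ ∈ W ∧ W ⊆ U ∧
      ∀ Tt : Pt (n+1) → Pt (n+1),
        ContDiffOn ℝ (⊤ : ℕ∞) Tt W →
        (∀ x ∈ W, lieB ξ Tt x = 0) →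
        (∀ u ∈ S.V, S.F u ∈ W →
          Tt (S.F u) = ξ (S.F u) - minner g (S.F u) (ξ (S.F u)) (S.N u) • S.N u) →
        IsKillingOn W g Tt := by
  obtain ⟨r, Φ, η, hr, hΦ0, hΦ⟩ := exists_transport_cone hU hg hξs hS hu₀ htrans
  set D : Set (Pt n × ℝ) := {y | ‖y.1 - u₀‖ + |y.2| < r} with hD
  have hDo : IsOpen D := isOpen_lt (by fun_prop) continuous_const
  have hWo : IsOpen (Φ '' D) := by
    rw [isOpen_iff_mem_nhds]
    rintro _ ⟨y, hy, rfl⟩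
    obtain ⟨-, -, -, -, e, he, -⟩ := hΦ y hy
    rw [← he.map_nhds_eq_of_equiv]
    exact image_mem_map (hDo.mem_nhds hy)
  have hWU : Φ '' D ⊆ U := by
    rintro _ ⟨y, hy, rfl⟩
    exact (hΦ y hy).2.1
  refine ⟨Φ '' D, hWo, ⟨(u₀, 0), by simpa [hD] using hr, hΦ0 u₀⟩, hWU, fun Tt hT hbr hres => ?_⟩
  have hG2 (x) (hx : x ∈ Φ '' D) : ContDiffAt ℝ 2 (metricForm g) x :=
    ((contDiffOn_metricForm hg).contDiffAt (hU.mem_nhds (hWU hx))).of_le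
      (WithTop.coe_le_coe.2 le_top)
  have hξ2 (x) (hx : x ∈ Φ '' D) : ContDiffAt ℝ 2 ξ x :=
    (hξs.contDiffAt (hU.mem_nhds (hWU hx))).of_le (WithTop.coe_le_coe.2 le_top)
  have hT2 (x) (hx : x ∈ Φ '' D) : ContDiffAt ℝ 2 Tt x :=
    (hT.contDiffAt (hWo.mem_nhds hx)).of_le (WithTop.coe_le_coe.2 le_top)
  have hd (x) (hx : x ∈ Φ '' D) (i j) : DifferentiableAt ℝ (fun y => g y i j) x :=
    ((hg.1 i j).contDiffAt (hU.mem_nhds (hWU hx))).differentiableAt (by simp)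
  set A := lieFormCLM (metricForm g) Tt with hA
  have hAd (x) (hx : x ∈ Φ '' D) (v w) : DifferentiableAt ℝ (fun y => A y v w) x := by
    simp only [hA, lieFormCLM_apply]
    exact differentiableAt_lieForm (hG2 x hx) (hT2 x hx) v w
  have htransport (x) (hx : x ∈ Φ '' D) (v w) : fderiv ℝ (fun y => A y v w) x (ξ x)
      = -(A x (fderiv ℝ ξ x v) w + A x v (fderiv ℝ ξ x w)) := by
    have h := lieForm_lieForm_eq_zero (hG2 x hx) (hξ2 x hx) (hT2 x hx)
      (by
        filter_upwards [hWo.mem_nhds hx] with y hy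
        rw [← lieB_eq ((hξ2 y hy).differentiableAt (by norm_num))
          ((hT2 y hy).differentiableAt (by norm_num))]
        exact hbr y hy)
      (by
        filter_upwards [hWo.mem_nhds hx] with y hy v w
        rw [← minner_covD_add hU hg (hWU hy) ((hξ2 y hy).differentiableAt (by norm_num))]
        exact hξk y (hWU hy) v w) v w
    simp only [hA, lieFormCLM_apply]
    linarith
  set q : Pt (n+1) → ℝ := fun x => ∑ i, ∑ j, A x (stdb (n+1) i) (stdb (n+1) j) ^ 2 with hq
  have hqd (x) (hx : x ∈ Φ '' D) : HasFDerivAt q (∑ i, ∑ j,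
      (2 * A x (stdb (n+1) i) (stdb (n+1) j)) •
        fderiv ℝ (fun y => A y (stdb (n+1) i) (stdb (n+1) j)) x) x := by
    refine HasFDerivAt.fun_sum fun i _ => HasFDerivAt.fun_sum fun j _ => ?_
    have := (hAd x hx (stdb (n+1) i) (stdb (n+1) j)).hasFDerivAt.pow 2
    simpa using this
  have hqΦ (y) (hy : y ∈ D) : q (Φ y) = 0 := by
    refine eq_zero_of_transport (q := fun y => q (Φ y)) (η := η) (u₀ := u₀) (r := r)
      (fun y hy => ?_) (fun y _ => ?_) (fun y hy => ⟨(hΦ y hy).2.2.1, (hΦ y hy).2.2.2.1⟩)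
      (fun K hK hKD => ?_) (fun u hu => ?_) hy
    · obtain ⟨-, -, -, -, e, he, -⟩ := hΦ y hy
      exact ((hqd _ ⟨y, hy, rfl⟩).comp y he.hasFDerivAt).differentiableAt
    · exact Finset.sum_nonneg fun _ _ => Finset.sum_nonneg fun _ _ => sq_nonneg _
    · have hc : ContinuousOn (fun y => fderiv ℝ ξ (Φ y)) K := fun y hy => by
        obtain ⟨-, -, -, -, e, he, -⟩ := hΦ y (hKD y hy)
        have h1 := ((hξ2 (Φ y) ⟨y, hKD y hy, rfl⟩).fderiv_right (m := 1)
          (by norm_num)).continuousAt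
        exact (ContinuousAt.comp h1 he.continuousAt).continuousWithinAt
      obtain ⟨b, hb⟩ := hK.exists_bound_of_continuousOn hc
      refine ⟨((n+1 : ℕ) * ((n+1 : ℕ) * ((n+1 : ℕ) * b * 4))), fun y hy => ?_⟩
      obtain ⟨-, -, -, -, e, he, heη, -⟩ := hΦ y (hKD y hy)
      have hx : Φ y ∈ Φ '' D := ⟨y, hKD y hy, rfl⟩
      have h1 : fderiv ℝ (fun y => q (Φ y)) y (η y) = -∑ i, ∑ j,
          2 * (A (Φ y) (stdb (n+1) i) (stdb (n+1) j)) *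
          (A (Φ y) (fderiv ℝ ξ (Φ y) (stdb (n+1) i)) (stdb (n+1) j)
            + A (Φ y) (stdb (n+1) i) (fderiv ℝ ξ (Φ y) (stdb (n+1) j))) := by
        have h2 : HasFDerivAt (fun y => q (Φ y)) _ y := (hqd _ hx).comp y he.hasFDerivAt
        rw [h2.fderiv, ContinuousLinearMap.comp_apply, ContinuousLinearEquiv.coe_coe, heη]
        simp only [sum_apply, smul_apply, smul_eq_mul,
          htransport _ hx, mul_neg, Finset.sum_neg_distrib]
      rw [h1, abs_neg]
      exact abs_sum_mul_le _ _ (hb y hy)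
    · have hyD : ((u, 0) : Pt n × ℝ) ∈ D := by simpa [hD] using hu
      obtain ⟨huV, -, -, h2, e, -, heη, a, hea⟩ := hΦ (u, 0) hyD
      have hFW : S.F u ∈ Φ '' D := ⟨(u, 0), hyD, hΦ0 u⟩
      obtain ⟨k1, k2, k3⟩ := lieForm_eq_zero_of_totallyGeodesic hU hg hξs hξu hξk hS hgeo hWo
        hT hbr hres huV hFW
      have k4 (v) : A (S.F u) (ξ (S.F u)) (fderiv ℝ S.F u v) = 0 := by
        rw [hA, lieFormCLM_apply, lieForm_comm hg.2.1 (hd _ hFW)]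
        exact k2 v
      simp only [← lieFormCLM_apply, ← hA] at k1 k2 k3
      have hspan (z : Pt (n+1)) : ∃ (v : Pt n) (s : ℝ),
          z = fderiv ℝ S.F u v + s • ξ (S.F u) := by
        obtain ⟨⟨v, s⟩, rfl⟩ := e.surjective z
        have h3 : ξ (S.F u) = fderiv ℝ S.F u (η (u, 0)).1 + (η (u, 0)).2 • a := by
          rw [← hea, ← hΦ0, ← heη]
        have h4 : (η (u, 0)).2 ≠ 0 := by linarith
        refine ⟨v - (s / (η (u, 0)).2) • (η (u, 0)).1, s / (η (u, 0)).2, ?_⟩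
        rw [hea, h3, map_sub, map_smul, smul_add, smul_smul, div_mul_cancel₀ _ h4]
        abel
      have hzero (z z') : A (S.F u) z z' = 0 := by
        obtain ⟨v, s, rfl⟩ := hspan z
        obtain ⟨v', s', rfl⟩ := hspan z'
        simp [k1, k2, k3, k4]
      simp [hq, hΦ0, hzero]
  rintro _ ⟨y, hy, rfl⟩ v w
  have hx : Φ y ∈ Φ '' D := ⟨y, hy, rfl⟩
  rw [minner_covD_add hU hg (hWU hx) ((hT2 _ hx).differentiableAt (by norm_num)),
    ← lieFormCLM_apply, ← hA]
  have hij (i j) : A (Φ y) (stdb (n+1) i) (stdb (n+1) j) = 0 := by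
    have h1 := hqΦ y hy
    rw [hq, Finset.sum_eq_zero_iff_of_nonneg
      (fun _ _ => Finset.sum_nonneg fun _ _ => sq_nonneg _)] at h1
    have h2 := h1 i (Finset.mem_univ i)
    rw [Finset.sum_eq_zero_iff_of_nonneg (fun _ _ => sq_nonneg _)] at h2
    exact pow_eq_zero_iff two_ne_zero |>.1 (h2 j (Finset.mem_univ j))
  rw [eq_sum_stdb v, eq_sum_stdb w]
  simp [map_sum, hij]

end

/-- Proposition 3.  Let `Σ` be a totally geodesic hypersurface of a
Riemannian manifold `M` admitting a unit Killing field `ξ`, and suppose `ξ` is not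
tangent to `Σ` at some point.  Then the field obtained by extending the tangential part
`T = ξ - νN` of `ξ` to a neighborhood of this point by means of the local flow of `ξ`
(i.e. any smooth field commuting with `ξ` and restricting to `T` on `Σ`) is a local
Killing field of `M`. -/
theorem statement7 {n : ℕ} (U : Set (Pt (n+1))) (hU : IsOpen U)
    (g : Met (n+1)) (hg : IsMetricOn U g)
    (ξ : Pt (n+1) → Pt (n+1)) (hξs : ContDiffOn ℝ (⊤ : ℕ∞) ξ U)
    (hξu : IsUnitOn U g ξ) (hξk : IsKillingOn U g ξ)
    (S : Hyp n) (hS : S.IsRegular U g) (hgeo : S.TotallyGeodesic g)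
    (u₀ : Pt n) (hu₀ : u₀ ∈ S.V)
    -- `ξ` is not tangent to `Σ` at `F u₀`:
    (htrans : minner g (S.F u₀) (ξ (S.F u₀)) (S.N u₀) ≠ 0) :
    ∃ W : Set (Pt (n+1)), IsOpen W ∧ S.F u₀ ∈ W ∧ W ⊆ U ∧
      ∀ Tt : Pt (n+1) → Pt (n+1),
        ContDiffOn ℝ (⊤ : ℕ∞) Tt W →
        -- `Tt` is invariant under the flow of `ξ`:
        (∀ x ∈ W, lieB ξ Tt x = 0) →
        -- `Tt` restricts to `T = ξ - νN` on `Σ`: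
        (∀ u ∈ S.V, S.F u ∈ W →
          Tt (S.F u) = ξ (S.F u) - minner g (S.F u) (ξ (S.F u)) (S.N u) • S.N u) →
        IsKillingOn W g Tt := by
  exact isKillingOn_of_invariant_extension hU hg hξs hξu hξk hS hgeo hu₀ htrans
end
end

section
/- Let M³ be an oriented Riemannian three-manifold carrying a unit Killing field ξ, with Levi-Civita connection ∇̃ and cross product ×. Then there exists a real-valued function τ on M³ satisfying ξ(τ) = 0 such that ∇̃_X ξ = τ (X × ξ) for all vector fields X on M³. -/
noncomputable section
open Real Set

/-- A linear functional on `ℝⁿ` in terms of its values on the coordinate vectors. -/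
theorem clm_eq_sum_stdb {n : ℕ} (L : Pt n →L[ℝ] ℝ) (v : Pt n) :
    L v = ∑ i, v i * L (stdb n i) := by
  conv_lhs => rw [pi_eq_sum_univ' v]
  simp only [map_sum, map_smul, smul_eq_mul]
  rfl

theorem minner_stdb {n : ℕ} (g : Met n) (x z : Pt n) (l : Fin n) :
    minner g x z (stdb n l) = ∑ k, g x k l * z k := by
  simp [minner, stdb, Pi.single_apply]

theorem minner_eq_sum_stdb {n : ℕ} (g : Met n) (x z w : Pt n) :
    minner g x z w = ∑ l, w l * minner g x z (stdb n l) := by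
  simp only [minner_stdb, Finset.mul_sum]
  rw [Finset.sum_comm]
  refine Finset.sum_congr rfl fun i _ => Finset.sum_congr rfl fun j _ => ?_
  ring

/-- A vector is determined by its inner products with the coordinate vectors. -/
theorem eq_of_minner_stdb {n : ℕ} {g : Met n} {x : Pt n}
    (hpos : ∀ v : Pt n, v ≠ 0 → 0 < minner g x v v) {u w : Pt n}
    (h : ∀ l, minner g x u (stdb n l) = minner g x w (stdb n l)) : u = w := by
  by_contra hne
  have h0 := hpos (u - w) (sub_ne_zero.2 hne)
  rw [minner_eq_sum_stdb] at h0
  refine h0.ne' (Finset.sum_eq_zero fun l _ => ?_)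
  have hl := h l
  simp only [minner_stdb] at hl ⊢
  simp [mul_sub, hl]

theorem det_pos_of_minner_pos {n : ℕ} {g : Met n} {x : Pt n}
    (hsymm : ∀ i j, g x i j = g x j i)
    (hpos : ∀ v : Pt n, v ≠ 0 → 0 < minner g x v v) : 0 < (Matrix.of (g x)).det := by
  refine Matrix.PosDef.det_pos (Matrix.PosDef.of_dotProduct_mulVec_pos ?_ fun v hv => ?_)
  · ext i j
    simpa using hsymm j i
  · have h : star v ⬝ᵥ (Matrix.of (g x)).mulVec v = minner g x v v := by
      simp only [minner, dotProduct, Matrix.mulVec, Finset.mul_sum]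
      refine Finset.sum_congr rfl fun i _ => Finset.sum_congr rfl fun j _ => ?_
      rw [Pi.star_apply, star_trivial, Matrix.of_apply]
      ring
    exact h ▸ hpos v hv

/-- Lowering the index of a vector given by raising the index of a covector. -/
theorem sum_mul_ginv_s8 {n : ℕ} {g : Met n} {x : Pt n} (hsymm : ∀ i j, g x i j = g x j i)
    (hdet : (Matrix.of (g x)).det ≠ 0) (α : Fin n → ℝ) (l : Fin n) :
    ∑ k, g x k l * ∑ m, ginv g x k m * α m = α l := by
  have h : Matrix.of (g x) * (Matrix.of (g x))⁻¹ = 1 :=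
    Matrix.mul_nonsing_inv _ (isUnit_iff_ne_zero.2 hdet)
  have h2 : (Matrix.of (g x)).mulVec ((Matrix.of (g x))⁻¹.mulVec α) = α := by
    rw [Matrix.mulVec_mulVec, h, Matrix.one_mulVec]
  have h3 := congrFun h2 l
  simpa [Matrix.mulVec, dotProduct, ginv, hsymm l] using h3

theorem sum_mul_christoffel {n : ℕ} {g : Met n} {x : Pt n} (hsymm : ∀ i j, g x i j = g x j i)
    (hdet : (Matrix.of (g x)).det ≠ 0) (i j l : Fin n) :
    ∑ k, g x k l * christoffel g x k i j = (1 / 2) *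
      (fderiv ℝ (fun y => g y j l) x (stdb n i) + fderiv ℝ (fun y => g y i l) x (stdb n j)
        - fderiv ℝ (fun y => g y i j) x (stdb n l)) := by
  rw [← sum_mul_ginv_s8 hsymm hdet (fun l => fderiv ℝ (fun y => g y j l) x (stdb n i)
    + fderiv ℝ (fun y => g y i l) x (stdb n j) - fderiv ℝ (fun y => g y i j) x (stdb n l)) l,
    Finset.mul_sum]
  refine Finset.sum_congr rfl fun k _ => ?_
  rw [christoffel]
  ring

/-- The components `⟨∇_{∂ᵢ} Y, ∂ₗ⟩` of the covariant derivative. -/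
def covDLow {n : ℕ} (g : Met n) (Y : Pt n → Pt n) (x : Pt n) (i l : Fin n) : ℝ :=
  ∑ k, g x k l * fderiv ℝ (fun y => Y y k) x (stdb n i) + ∑ j, (1 / 2) *
      (fderiv ℝ (fun y => g y j l) x (stdb n i) + fderiv ℝ (fun y => g y i l) x (stdb n j)
        - fderiv ℝ (fun y => g y i j) x (stdb n l)) * Y x j

theorem minner_covD_stdb {n : ℕ} {g : Met n} {x : Pt n} (hsymm : ∀ i j, g x i j = g x j i)
    (hdet : (Matrix.of (g x)).det ≠ 0) (Y : Pt n → Pt n) (v : Pt n) (l : Fin n) :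
    minner g x (covD g Y x v) (stdb n l) = ∑ i, v i * covDLow g Y x i l := by
  simp only [minner_stdb, covD, covDLow, mul_add, Finset.sum_add_distrib,
    ← sum_mul_christoffel hsymm hdet, clm_eq_sum_stdb _ v]
  congr 1
  · simp only [Finset.mul_sum]
    rw [Finset.sum_comm]
    refine Finset.sum_congr rfl fun i _ => Finset.sum_congr rfl fun k _ => ?_
    ring
  · simp only [Finset.mul_sum, Finset.sum_mul]
    rw [Finset.sum_comm]
    refine Finset.sum_congr rfl fun i _ => ?_
    rw [Finset.sum_comm]
    refine Finset.sum_congr rfl fun j _ => Finset.sum_congr rfl fun k _ => ?_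
    ring

theorem IsKillingOn.covDLow_add {n : ℕ} {U : Set (Pt n)} {g : Met n} {ξ : Pt n → Pt n}
    (hk : IsKillingOn U g ξ) {x : Pt n} (hx : x ∈ U) (hsymm : ∀ i j, g x i j = g x j i)
    (hdet : (Matrix.of (g x)).det ≠ 0) (i l : Fin n) :
    covDLow g ξ x i l + covDLow g ξ x l i = 0 := by
  have h := hk x hx (stdb n i) (stdb n l)
  rw [minner_covD_stdb hsymm hdet, minner_covD_stdb hsymm hdet] at h
  simpa [stdb, Pi.single_apply] using h

theorem minner_crossG_stdb {g : Met 3} {x : Pt 3} (hsymm : ∀ i j, g x i j = g x j i)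
    (hdet : (Matrix.of (g x)).det ≠ 0) (v w : Pt 3) (l : Fin 3) :
    minner g x (crossG g x v w) (stdb 3 l)
      = √(Matrix.of (g x)).det * ∑ i, ∑ j, lcSymb l i j * v i * w j := by
  rw [minner_stdb, ← sum_mul_ginv_s8 hsymm hdet (fun l => ∑ i, ∑ j, lcSymb l i j * v i * w j) l,
    Finset.mul_sum]
  refine Finset.sum_congr rfl fun k _ => ?_
  rw [crossG]
  ring

/-- The `j`-th component of the covector field dual to `Y`. -/
def lowerVec {n : ℕ} (g : Met n) (Y : Pt n → Pt n) (j : Fin n) (x : Pt n) : ℝ :=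
  ∑ k, g x j k * Y x k

theorem fderiv_lowerVec {n : ℕ} {g : Met n} {Y : Pt n → Pt n} {x : Pt n}
    (hg : ∀ i j, DifferentiableAt ℝ (fun y => g y i j) x)
    (hY : ∀ i, DifferentiableAt ℝ (fun y => Y y i) x) (j : Fin n) (v : Pt n) :
    fderiv ℝ (lowerVec g Y j) x v = ∑ k, (g x j k * fderiv ℝ (fun y => Y y k) x v
      + fderiv ℝ (fun y => g y j k) x v * Y x k) := by
  have h : HasFDerivAt (lowerVec g Y j) (∑ k, (g x j k • fderiv ℝ (fun y => Y y k) x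
      + Y x k • fderiv ℝ (fun y => g y j k) x)) x :=
    HasFDerivAt.fun_sum fun k _ => (hg j k).hasFDerivAt.mul (hY k).hasFDerivAt
  rw [h.fderiv]
  simp [mul_comm]

/-- The curl (in coordinates) of a covector field on a three-dimensional chart. -/
def curl3 (h : Fin 3 → Pt 3 → ℝ) (k : Fin 3) (x : Pt 3) : ℝ :=
  fderiv ℝ (h (k + 2)) x (stdb 3 (k + 1)) - fderiv ℝ (h (k + 1)) x (stdb 3 (k + 2))

theorem ContDiffOn.curl3 {U : Set (Pt 3)} (hU : IsOpen U) {h : Fin 3 → Pt 3 → ℝ}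
    (hh : ∀ k, ContDiffOn ℝ (⊤ : ℕ∞) (h k) U) (k : Fin 3) :
    ContDiffOn ℝ (⊤ : ℕ∞) (curl3 h k) U :=
  (((hh _).fderiv_of_isOpen hU (by simp)).clm_apply contDiffOn_const).sub
    (((hh _).fderiv_of_isOpen hU (by simp)).clm_apply contDiffOn_const)

/-- The divergence of a curl vanishes. -/
theorem div_curl3 {U : Set (Pt 3)} (hU : IsOpen U) {h : Fin 3 → Pt 3 → ℝ}
    (hh : ∀ k, ContDiffOn ℝ (⊤ : ℕ∞) (h k) U) {x : Pt 3} (hx : x ∈ U) :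
    ∑ k, fderiv ℝ (curl3 h k) x (stdb 3 k) = 0 := by
  have hd : ∀ k, DifferentiableAt ℝ (fderiv ℝ (h k)) x := fun k =>
    (((hh k).fderiv_of_isOpen (m := (⊤ : ℕ∞)) hU (by simp)).contDiffAt
      (hU.mem_nhds hx)).differentiableAt (by simp)
  have hs : ∀ k v w, fderiv ℝ (fderiv ℝ (h k)) x v w = fderiv ℝ (fderiv ℝ (h k)) x w v :=
    fun k v w => (((hh k).contDiffAt (hU.mem_nhds hx)).isSymmSndFDerivAt
      (by
      rw [minSmoothness_of_isRCLikeNormedField]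
      exact WithTop.coe_le_coe.2 le_top)) v w
  have hc : ∀ k v, fderiv ℝ (curl3 h k) x v
      = fderiv ℝ (fderiv ℝ (h (k + 2))) x v (stdb 3 (k + 1))
        - fderiv ℝ (fderiv ℝ (h (k + 1))) x v (stdb 3 (k + 2)) := by
    intro k v
    have h1 : HasFDerivAt (curl3 h k) _ x :=
      ((hd (k + 2)).hasFDerivAt.clm_apply (hasFDerivAt_const (stdb 3 (k + 1)) x)).sub
        ((hd (k + 1)).hasFDerivAt.clm_apply (hasFDerivAt_const (stdb 3 (k + 2)) x))
    rw [h1.fderiv]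
    simp
  simp only [Fin.sum_univ_three, hc, Fin.isValue, Fin.reduceAdd, zero_add]
  linarith [hs 0 (stdb 3 1) (stdb 3 2), hs 1 (stdb 3 2) (stdb 3 0), hs 2 (stdb 3 0) (stdb 3 1)]

theorem fderiv_det_fin_three {g : Met 3} {x : Pt 3}
    (hg : ∀ i j, DifferentiableAt ℝ (fun y => g y i j) x) (v : Pt 3) :
    fderiv ℝ (fun y => (Matrix.of (g y)).det) x v =
      (g x 1 1 * g x 2 2 - g x 1 2 * g x 2 1) * fderiv ℝ (fun y => g y 0 0) x v
      + (g x 1 2 * g x 2 0 - g x 1 0 * g x 2 2) * fderiv ℝ (fun y => g y 0 1) x v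
      + (g x 1 0 * g x 2 1 - g x 1 1 * g x 2 0) * fderiv ℝ (fun y => g y 0 2) x v
      + (g x 0 2 * g x 2 1 - g x 0 1 * g x 2 2) * fderiv ℝ (fun y => g y 1 0) x v
      + (g x 0 0 * g x 2 2 - g x 0 2 * g x 2 0) * fderiv ℝ (fun y => g y 1 1) x v
      + (g x 0 1 * g x 2 0 - g x 0 0 * g x 2 1) * fderiv ℝ (fun y => g y 1 2) x v
      + (g x 0 1 * g x 1 2 - g x 0 2 * g x 1 1) * fderiv ℝ (fun y => g y 2 0) x v
      + (g x 0 2 * g x 1 0 - g x 0 0 * g x 1 2) * fderiv ℝ (fun y => g y 2 1) x v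
      + (g x 0 0 * g x 1 1 - g x 0 1 * g x 1 0) * fderiv ℝ (fun y => g y 2 2) x v := by
  have h := fun i j => (hg i j).hasFDerivAt
  have hp := fun a b c d e f => ((h a b).mul (h c d)).mul (h e f)
  simp only [Matrix.det_fin_three, Matrix.of_apply]
  have hD := (((((hp 0 0 1 1 2 2).sub (hp 0 0 1 2 2 1)).sub (hp 0 1 1 0 2 2)).add
    (hp 0 1 1 2 2 0)).add (hp 0 2 1 0 2 1)).sub (hp 0 2 1 1 2 0)
  refine (congrArg (fun L : Pt 3 →L[ℝ] ℝ => L v) hD.fderiv).trans ?_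
  simp
  ring

/-- Along a Killing field `ξ`, `ξ (det g) = -2 (det g) ∂ₖξᵏ`: Killing fields are
divergence free. -/
theorem IsKillingOn.fderiv_det {U : Set (Pt 3)} {g : Met 3} {ξ : Pt 3 → Pt 3}
    (hk : IsKillingOn U g ξ) {x : Pt 3} (hx : x ∈ U) (hsymm : ∀ x i j, g x i j = g x j i)
    (hdet : (Matrix.of (g x)).det ≠ 0)
    (hg : ∀ i j, DifferentiableAt ℝ (fun y => g y i j) x) :
    fderiv ℝ (fun y => (Matrix.of (g y)).det) x (ξ x) = -2 * (Matrix.of (g x)).det *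
      ∑ k, fderiv ℝ (fun y => ξ y k) x (stdb 3 k) := by
  have hL := hk.covDLow_add hx (hsymm x) hdet
  rw [fderiv_det_fin_three hg, Matrix.det_fin_three]
  simp only [clm_eq_sum_stdb _ (ξ x), Fin.sum_univ_three, Matrix.of_apply]
  simp only [covDLow, Fin.sum_univ_three] at hL
  have h00 := hL 0 0
  have h01 := hL 0 1
  have h02 := hL 0 2
  have h11 := hL 1 1
  have h12 := hL 1 2
  have h22 := hL 2 2
  clear hL
  simp only [fun y => hsymm y 1 0, fun y => hsymm y 2 0, fun y => hsymm y 2 1] at *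
  linear_combination (g x 1 1 * g x 2 2 - g x 1 2 * g x 1 2) * h00
    + 2 * (g x 1 2 * g x 0 2 - g x 0 1 * g x 2 2) * h01
    + 2 * (g x 0 1 * g x 1 2 - g x 1 1 * g x 0 2) * h02
    + (g x 0 0 * g x 2 2 - g x 0 2 * g x 0 2) * h11
    + 2 * (g x 0 1 * g x 0 2 - g x 0 0 * g x 1 2) * h12
    + (g x 0 0 * g x 1 1 - g x 0 1 * g x 0 1) * h22

/-- For a Killing field `ξ`, the form `⟨∇ξ, ·⟩` is half the exterior derivative of the dual
covector field. -/
theorem IsKillingOn.covDLow_eq {n : ℕ} {U : Set (Pt n)} {g : Met n} {ξ : Pt n → Pt n}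
    (hk : IsKillingOn U g ξ) {x : Pt n} (hx : x ∈ U) (hsymm : ∀ x i j, g x i j = g x j i)
    (hdet : (Matrix.of (g x)).det ≠ 0)
    (hg : ∀ i j, DifferentiableAt ℝ (fun y => g y i j) x)
    (hξ : ∀ i, DifferentiableAt ℝ (fun y => ξ y i) x) (i l : Fin n) :
    covDLow g ξ x i l = (1 / 2) * (fderiv ℝ (lowerVec g ξ l) x (stdb n i)
      - fderiv ℝ (lowerVec g ξ i) x (stdb n l)) := by
  have h := hk.covDLow_add hx (hsymm x) hdet i l
  have h2 : covDLow g ξ x i l - covDLow g ξ x l i = fderiv ℝ (lowerVec g ξ l) x (stdb n i)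
      - fderiv ℝ (lowerVec g ξ i) x (stdb n l) := by
    rw [fderiv_lowerVec hg hξ, fderiv_lowerVec hg hξ, covDLow, covDLow]
    simp only [← Finset.sum_add_distrib, ← Finset.sum_sub_distrib]
    refine Finset.sum_congr rfl fun k _ => ?_
    simp only [fun y => hsymm y k l, fun y => hsymm y k i, fun y => hsymm y l i]
    ring
  linarith

/-- The covariant derivative of a unit field is orthogonal to it. -/
theorem IsUnitOn.sum_covDLow {n : ℕ} {U : Set (Pt n)} (hU : IsOpen U) {g : Met n}
    {ξ : Pt n → Pt n} (hu : IsUnitOn U g ξ) {x : Pt n} (hx : x ∈ U)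
    (hsymm : ∀ x i j, g x i j = g x j i)
    (hg : ∀ i j, DifferentiableAt ℝ (fun y => g y i j) x)
    (hξ : ∀ i, DifferentiableAt ℝ (fun y => ξ y i) x) (i : Fin n) :
    ∑ l, covDLow g ξ x i l * ξ x l = 0 := by
  have hn : (fun y => minner g y (ξ y) (ξ y)) =ᶠ[nhds x] fun _ => 1 :=
    Filter.eventuallyEq_of_mem (hU.mem_nhds hx) hu
  have h1 : HasFDerivAt (fun y => minner g y (ξ y) (ξ y)) _ x :=
    HasFDerivAt.fun_sum fun i _ => HasFDerivAt.fun_sum fun j _ =>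
      ((hg i j).hasFDerivAt.mul (hξ i).hasFDerivAt).mul (hξ j).hasFDerivAt
  have h2 := congrArg (fun L : Pt n →L[ℝ] ℝ => L (stdb n i)) (h1.fderiv.symm.trans hn.fderiv_eq)
  simp only [fderiv_fun_const, Pi.zero_apply, zero_apply, sum_apply, add_apply,
    smul_apply, Pi.mul_apply, smul_eq_mul] at h2
  have hA : ∑ l, ∑ k, fderiv ℝ (fun y => g y i l) x (stdb n k) * ξ x k * ξ x l
      = ∑ l, ∑ k, fderiv ℝ (fun y => g y i k) x (stdb n l) * ξ x k * ξ x l := by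
    rw [Finset.sum_comm]
    refine Finset.sum_congr rfl fun l _ => Finset.sum_congr rfl fun k _ => ?_
    ring
  have hB : ∑ k, ∑ l, g x k l * ξ x k * fderiv ℝ (fun y => ξ y l) x (stdb n i)
      = ∑ l, ∑ k, g x k l * fderiv ℝ (fun y => ξ y k) x (stdb n i) * ξ x l := by
    refine Finset.sum_congr rfl fun l _ => Finset.sum_congr rfl fun k _ => ?_
    rw [hsymm x k l]
    ring
  have hC : ∑ k, ∑ l, g x k l * fderiv ℝ (fun y => ξ y k) x (stdb n i) * ξ x l
      = ∑ l, ∑ k, g x k l * fderiv ℝ (fun y => ξ y k) x (stdb n i) * ξ x l :=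
    Finset.sum_comm
  have hD : ∑ k, ∑ l, fderiv ℝ (fun y => g y k l) x (stdb n i) * ξ x k * ξ x l
      = ∑ l, ∑ k, fderiv ℝ (fun y => g y k l) x (stdb n i) * ξ x k * ξ x l :=
    Finset.sum_comm
  have h3 : (∑ k, ∑ l, g x k l * ξ x k * fderiv ℝ (fun y => ξ y l) x (stdb n i))
      + (∑ k, ∑ l, g x k l * fderiv ℝ (fun y => ξ y k) x (stdb n i) * ξ x l)
      + ∑ k, ∑ l, fderiv ℝ (fun y => g y k l) x (stdb n i) * ξ x k * ξ x l = 0 := by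
    rw [← h2]
    simp only [← Finset.sum_add_distrib]
    refine Finset.sum_congr rfl fun l _ => Finset.sum_congr rfl fun k _ => ?_
    ring
  have h4 : ∑ l, covDLow g ξ x i l * ξ x l
      = (∑ l, ∑ k, g x k l * fderiv ℝ (fun y => ξ y k) x (stdb n i) * ξ x l)
      + (1 / 2) * (∑ l, ∑ k, fderiv ℝ (fun y => g y k l) x (stdb n i) * ξ x k * ξ x l)
      + (1 / 2) * (∑ l, ∑ k, fderiv ℝ (fun y => g y i l) x (stdb n k) * ξ x k * ξ x l)
      - (1 / 2) * ∑ l, ∑ k, fderiv ℝ (fun y => g y i k) x (stdb n l) * ξ x k * ξ x l := by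
    simp only [covDLow, add_mul, Finset.sum_mul, Finset.mul_sum, ← Finset.sum_add_distrib,
      ← Finset.sum_sub_distrib]
    refine Finset.sum_congr rfl fun l _ => Finset.sum_congr rfl fun k _ => ?_
    ring
  linarith

/-- In dimension three, `⟨∇ξ, ·⟩` is half the contraction of the volume symbol with the curl of
the covector field dual to the Killing field `ξ`. -/
theorem IsKillingOn.covDLow_eq_curl3 {U : Set (Pt 3)} {g : Met 3} {ξ : Pt 3 → Pt 3}
    (hk : IsKillingOn U g ξ) {x : Pt 3} (hx : x ∈ U) (hsymm : ∀ x i j, g x i j = g x j i)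
    (hdet : (Matrix.of (g x)).det ≠ 0)
    (hg : ∀ i j, DifferentiableAt ℝ (fun y => g y i j) x)
    (hξ : ∀ i, DifferentiableAt ℝ (fun y => ξ y i) x) (i l : Fin 3) :
    covDLow g ξ x i l = (1 / 2) * ∑ m, lcSymb i l m * curl3 (lowerVec g ξ) m x := by
  rw [hk.covDLow_eq hx hsymm hdet hg hξ]
  fin_cases i <;> fin_cases l <;>
    simp [Fin.sum_univ_three, lcSymb, curl3] <;> norm_num

/-- The curl of the dual covector field of a unit Killing field `ξ` is a multiple of `ξ`. -/
theorem curl3_lowerVec_eq {U : Set (Pt 3)} (hU : IsOpen U) {g : Met 3} {ξ : Pt 3 → Pt 3}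
    (hu : IsUnitOn U g ξ) (hk : IsKillingOn U g ξ) {x : Pt 3} (hx : x ∈ U)
    (hsymm : ∀ x i j, g x i j = g x j i) (hdet : (Matrix.of (g x)).det ≠ 0)
    (hg : ∀ i j, DifferentiableAt ℝ (fun y => g y i j) x)
    (hξ : ∀ i, DifferentiableAt ℝ (fun y => ξ y i) x) (k : Fin 3) :
    curl3 (lowerVec g ξ) k x
      = (∑ m, curl3 (lowerVec g ξ) m x * lowerVec g ξ m x) * ξ x k := by
  have h := hu.sum_covDLow hU hx hsymm hg hξ
  simp only [hk.covDLow_eq_curl3 hx hsymm hdet hg hξ] at h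
  have hn : ∑ m, lowerVec g ξ m x * ξ x m = 1 := by
    rw [← hu x hx]
    simp only [minner, lowerVec, Finset.sum_mul]
    refine Finset.sum_congr rfl fun i _ => Finset.sum_congr rfl fun j _ => ?_
    ring
  have h0 := h 0
  have h1 := h 1
  have h2 := h 2
  simp [Fin.sum_univ_three, lcSymb] at h0 h1 h2 hn ⊢
  norm_num at h0 h1 h2
  fin_cases k <;> simp only [Fin.zero_eta, Fin.mk_one, Fin.reduceFinMk]
  · linear_combination -curl3 (lowerVec g ξ) 0 x * hn - 2 * lowerVec g ξ 1 x * h2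
      + 2 * lowerVec g ξ 2 x * h1
  · linear_combination -curl3 (lowerVec g ξ) 1 x * hn + 2 * lowerVec g ξ 0 x * h2
      - 2 * lowerVec g ξ 2 x * h0
  · linear_combination -curl3 (lowerVec g ξ) 2 x * hn - 2 * lowerVec g ξ 0 x * h1
      + 2 * lowerVec g ξ 1 x * h0

/-- Lemma 2.  Let `M³` be an oriented Riemannian three-manifold
carrying a unit Killing field `ξ`.  Then there is a real-valued function `τ` on `M³`
with `ξ(τ) = 0` such that `∇̃_X ξ = τ (X × ξ)` for all vector fields `X`. -/
theorem statement8 (U : Set (Pt 3)) (hU : IsOpen U)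
    (g : Met 3) (hg : IsMetricOn U g)
    (ξ : Pt 3 → Pt 3) (hξs : ContDiffOn ℝ (⊤ : ℕ∞) ξ U)
    (hξu : IsUnitOn U g ξ) (hξk : IsKillingOn U g ξ) :
    ∃ τ : Pt 3 → ℝ, ContDiffOn ℝ (⊤ : ℕ∞) τ U ∧
      (∀ x ∈ U, fderiv ℝ τ x (ξ x) = 0) ∧
      (∀ x ∈ U, ∀ v : Pt 3, covD g ξ x v = τ x • crossG g x v (ξ x)) := by
  obtain ⟨hgs, hsymm, hpos⟩ := hg
  have hD : ∀ x ∈ U, 0 < (Matrix.of (g x)).det := fun x hx =>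
    det_pos_of_minner_pos (hsymm x) (hpos x hx)
  have hξc : ∀ i, ContDiffOn ℝ (⊤ : ℕ∞) (fun y => ξ y i) U := contDiffOn_pi.1 hξs
  have hdiff : ∀ f : Pt 3 → ℝ, ContDiffOn ℝ (⊤ : ℕ∞) f U → ∀ x ∈ U, DifferentiableAt ℝ f x :=
    fun f hf x hx => (hf.contDiffAt (hU.mem_nhds hx)).differentiableAt (by simp)
  have hgd := fun x hx i j => hdiff _ (hgs i j) x hx
  have hξd := fun x hx i => hdiff _ (hξc i) x hx
  have hh : ∀ j, ContDiffOn ℝ (⊤ : ℕ∞) (lowerVec g ξ j) U := fun j =>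
    ContDiffOn.sum fun k _ => (hgs j k).mul (hξc k)
  have hDs : ContDiffOn ℝ (⊤ : ℕ∞) (fun y => (Matrix.of (g y)).det) U := by
    simp only [Matrix.det_fin_three, Matrix.of_apply]
    have hp := fun a b c d e f => ((hgs a b).mul (hgs c d)).mul (hgs e f)
    exact (((((hp 0 0 1 1 2 2).sub (hp 0 0 1 2 2 1)).sub (hp 0 1 1 0 2 2)).add
      (hp 0 1 1 2 2 0)).add (hp 0 2 1 0 2 1)).sub (hp 0 2 1 1 2 0)
  have hsD : ContDiffOn ℝ (⊤ : ℕ∞) (fun y => √(Matrix.of (g y)).det) U :=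
    hDs.sqrt fun x hx => (hD x hx).ne'
  have hs0 : ∀ x ∈ U, √(Matrix.of (g x)).det ≠ 0 := fun x hx => (Real.sqrt_pos.2 (hD x hx)).ne'
  set W := curl3 (lowerVec g ξ) with hW
  set c : Pt 3 → ℝ := fun y => ∑ m, W m y * lowerVec g ξ m y with hc
  have hcs : ContDiffOn ℝ (⊤ : ℕ∞) c U :=
    ContDiffOn.sum fun m _ => (ContDiffOn.curl3 hU hh m).mul (hh m)
  have hWc : ∀ x ∈ U, ∀ k, W k x = c x * ξ x k := fun x hx k =>
    curl3_lowerVec_eq hU hξu hξk hx hsymm (hD x hx).ne' (hgd x hx) (hξd x hx) k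
  have hτs : ContDiffOn ℝ (⊤ : ℕ∞) (fun y => -(1 / 2) * (c y / √(Matrix.of (g y)).det)) U :=
    contDiffOn_const.mul (hcs.div hsD hs0)
  refine ⟨_, hτs, fun x hx => ?_, fun x hx v => ?_⟩
  · have hdc : fderiv ℝ c x (ξ x) = -c x * ∑ k, fderiv ℝ (fun y => ξ y k) x (stdb 3 k) := by
      have hdiv := div_curl3 hU hh hx
      have hWd : ∀ k, fderiv ℝ (W k) x (stdb 3 k)
          = c x * fderiv ℝ (fun y => ξ y k) x (stdb 3 k)
            + ξ x k * fderiv ℝ c x (stdb 3 k) := by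
        intro k
        have he : W k =ᶠ[nhds x] fun y => c y * ξ y k :=
          Filter.eventuallyEq_of_mem (hU.mem_nhds hx) fun y hy => hWc y hy k
        rw [he.fderiv_eq, fderiv_fun_mul (hdiff _ hcs x hx) (hξd x hx k)]
        simp
      simp only [← hW, hWd, Finset.sum_add_distrib, ← Finset.mul_sum] at hdiv
      rw [clm_eq_sum_stdb _ (ξ x)]
      linarith
    have hdD := hξk.fderiv_det hx hsymm (hD x hx).ne' (hgd x hx)
    have hds : HasFDerivAt (fun y => √(Matrix.of (g y)).det) _ x :=
      (hdiff _ hDs x hx).hasFDerivAt.sqrt (hD x hx).ne'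
    have hprod : c =ᶠ[nhds x] fun y =>
        (-(1 / 2) * (c y / √(Matrix.of (g y)).det)) * (-2 * √(Matrix.of (g y)).det) :=
      Filter.eventuallyEq_of_mem (hU.mem_nhds hx) fun y hy => by
        have := hs0 y hy
        field_simp
    have h1 := congrArg (fun L : Pt 3 →L[ℝ] ℝ => L (ξ x)) (hprod.fderiv_eq.trans
      ((hdiff _ hτs x hx).hasFDerivAt.mul (hds.const_mul (-2))).fderiv)
    simp only [add_apply, smul_apply, smul_eq_mul,
      hdc, hdD] at h1
    have hsq := Real.mul_self_sqrt (hD x hx).le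
    have hs := hs0 x hx
    generalize fderiv ℝ (fun y => -(1 / 2) * (c y / √(Matrix.of (g y)).det)) x (ξ x) = T at *
    generalize √(Matrix.of (g x)).det = s at *
    rw [← hsq] at h1
    field_simp at h1
    have h2 : s * T = 0 := by linarith
    exact (mul_eq_zero.1 h2).resolve_left hs
  · refine eq_of_minner_stdb (hpos x hx) fun l => ?_
    have hdet := (hD x hx).ne'
    have hsm : ∀ (t : ℝ) (z : Pt 3), minner g x (t • z) (stdb 3 l)
        = t * minner g x z (stdb 3 l) := fun t z => by
      simp only [minner_stdb, Finset.mul_sum, Pi.smul_apply, smul_eq_mul]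
      exact Finset.sum_congr rfl fun k _ => by ring
    rw [minner_covD_stdb (hsymm x) hdet, hsm, minner_crossG_stdb (hsymm x) hdet, ← mul_assoc,
      mul_assoc (-(1 / 2)), div_mul_cancel₀ _ (hs0 x hx)]
    simp only [hξk.covDLow_eq_curl3 hx hsymm hdet (hgd x hx) (hξd x hx), ← hW, hWc x hx,
      Finset.mul_sum]
    refine Finset.sum_congr rfl fun i _ => Finset.sum_congr rfl fun m _ => ?_
    rw [lcSymb, lcSymb]
    ring
end
end
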